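/- arXiv:1105.2732 — 2 statements merged into one kernel-verified Lean document; each statement's English description precedes it below -/
import Mathlib

section
/- Let X be a Banach space, k ∈ ℕ, and (x_s)_{s∈[ℕ]^k} a weakly relatively compact k-sequence in X, i.e. the closure of {x_s : s ∈ [ℕ]^k} in the weak topology of X is weakly compact. Then there exists an infinite subset M of ℕ such that at least one of the following holds: (1) (x_s)_{s∈[M]^k} generates (with respect to some null sequence of positive reals) a k-spreading model equivalent to the usual basis of ℓ^1; (2) there exists x_0 ∈ X such that for every infinite subset L of M, (x_s)_{s∈[L]^k} is k-Cesàro summable to x_0. -/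
/-- `s : Fin k → ℕ` is the increasing enumeration of a `k`-element subset of `M`. -/
def IsEnum (M : Set ℕ) {k : ℕ} (s : Fin k → ℕ) : Prop :=
  StrictMono s ∧ ∀ i, s i ∈ M

/-- `(p j)_{j=1,…,l}` is a plegma family in `[M]^k`. -/
def IsPlegma (M : Set ℕ) {k l : ℕ} (p : Fin l → Fin k → ℕ) : Prop :=
  (∀ j, IsEnum M (p j)) ∧
  (∀ i : Fin k, StrictMono fun j : Fin l => p j i) ∧
  (∀ (i : Fin k) (hi : (i : ℕ) + 1 < k) (j j' : Fin l), p j i < p j' ⟨(i : ℕ) + 1, hi⟩)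


/-- A null sequence of positive reals. -/
def IsNullPos (δ : ℕ → ℝ) : Prop :=
  (∀ n, 0 < δ n) ∧ Filter.Tendsto δ Filter.atTop (nhds 0)

/-- The sequence `(e n)` is spreading with respect to the seminorm `ρ`:
`ρ (∑ a_i • e_i) = ρ (∑ a_i • e_{k_i})` for all strictly increasing `(k_i)`. -/
def IsSpreadingWith {E : Type*} [AddCommGroup E] [Module ℝ E]
    (ρ : Seminorm ℝ E) (e : ℕ → E) : Prop :=
  ∀ (n : ℕ) (a : Fin n → ℝ) (f : Fin n → ℕ), StrictMono f →
    ρ (∑ i, a i • e (i : ℕ)) = ρ (∑ i, a i • e (f i))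

/-- The `k`-subsequence `(x_s)_{s ∈ [M]^k}` generates `(e n)` (in the seminormed space
`(E, ρ)`) as a `k`-spreading model with respect to the null sequence `δ`: for all
`m ≤ l` (0-indexed), every plegma family `(p j)_{j=0}^{m}` in `[M]^k` whose first (hence
every) entry is `≥ M l`, and all coefficients in `[-1,1]`,
`| ‖∑ a_j • x_{p j}‖ - ρ (∑ a_j • e_j) | ≤ δ l`. The infinite set `M` is represented by
its increasing enumeration. -/
def Generates {X : Type*} [SeminormedAddCommGroup X] [NormedSpace ℝ X]
    {E : Type*} [AddCommGroup E] [Module ℝ E] (ρ : Seminorm ℝ E)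
    {k : ℕ} (x : (Fin k → ℕ) → X) (M : ℕ → ℕ) (e : ℕ → E) (δ : ℕ → ℝ) : Prop :=
  ∀ m l : ℕ, m ≤ l → ∀ p : Fin (m + 1) → Fin k → ℕ,
    IsPlegma (Set.range M) p →
    (∀ (j : Fin (m + 1)) (i : Fin k), M l ≤ p j i) →
    ∀ a : Fin (m + 1) → ℝ, (∀ j, a j ∈ Set.Icc (-1 : ℝ) 1) →
      |‖∑ j, a j • x (p j)‖ - ρ (∑ j, a j • e (j : ℕ))| ≤ δ l


/-- `(e n)` admits a lower `ℓ¹`-estimate of constant `c` with respect to the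
seminorm `ρ`. -/
def LowerL1 {E : Type*} [AddCommGroup E] [Module ℝ E]
    (ρ : Seminorm ℝ E) (e : ℕ → E) (c : ℝ) : Prop :=
  ∀ (n : ℕ) (a : Fin n → ℝ), c * ∑ i, |a i| ≤ ρ (∑ i, a i • e (i : ℕ))

/-- `(e n)` is equivalent to the usual basis of `ℓ¹` with respect to the seminorm `ρ`. -/
def EquivL1Basis {E : Type*} [AddCommGroup E] [Module ℝ E]
    (ρ : Seminorm ℝ E) (e : ℕ → E) : Prop :=
  ∃ c C : ℝ, 0 < c ∧ c ≤ C ∧ LowerL1 ρ e c ∧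
    ∀ (n : ℕ) (a : Fin n → ℝ), ρ (∑ i, a i • e (i : ℕ)) ≤ C * ∑ i, |a i|


/-- The (enumerations of the) `k`-element subsets of the finite set `F ⊆ ℕ`. -/
def kSubsetEnums (k : ℕ) (F : Finset ℕ) : Finset (Fin k → ℕ) :=
  (Fintype.piFinset fun _ : Fin k => F).filter fun s => ∀ i j : Fin k, i < j → s i < s j

/-- `(x s)_{s ∈ [M]^k}` is `k`-Cesàro summable to `x₀`:
`(n choose k)⁻¹ • ∑_{s ∈ [M|n]^k} x s → x₀` in norm, where `M|n` consists of the first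
`n` elements of `M`. -/
def KCesaroSummableTo {X : Type*} [SeminormedAddCommGroup X] [NormedSpace ℝ X]
    {k : ℕ} (M : ℕ → ℕ) (x : (Fin k → ℕ) → X) (x₀ : X) : Prop :=
  Filter.Tendsto
    (fun n => (n.choose k : ℝ)⁻¹ •
      ∑ s ∈ kSubsetEnums k ((Finset.range n).image M), x s)
    Filter.atTop (nhds x₀)


open Filter Topology

/-- Iterated tensor powers of a fixed nonprincipal ultrafilter. -/
noncomputable def VV : (N : ℕ) → Ultrafilter (Fin N → ℕ)
  | 0 => pure (fun i => i.elim0)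
  | N + 1 => (hyperfilter ℕ).bind (fun n => (VV N).map (fun t => (Fin.cons n t : Fin (N+1) → ℕ)))

theorem VV_zero {P : (Fin 0 → ℕ) → Prop} :
    (∀ᶠ t in (VV 0 : Filter (Fin 0 → ℕ)), P t) ↔ ∀ t, P t := by
  constructor
  · intro h t
    have : P (fun i => i.elim0) := h
    convert this
  · intro h
    exact Eventually.of_forall h

theorem VV_succ {N : ℕ} {P : (Fin (N+1) → ℕ) → Prop} :
    (∀ᶠ t in (VV (N+1) : Filter (Fin (N+1) → ℕ)), P t) ↔
    ∀ᶠ n in (hyperfilter ℕ : Filter ℕ), ∀ᶠ t in (VV N : Filter (Fin N → ℕ)),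
      P (Fin.cons n t) := Iff.rfl

theorem strictMono_pred {r N : ℕ} (g : Fin r → Fin (N+1)) (hg : StrictMono g)
    (h : ∀ i, g i ≠ 0) : ∃ g' : Fin r → Fin N, StrictMono g' ∧ ∀ i, g i = (g' i).succ := by
  refine ⟨fun i => (g i).pred (h i), fun i j hij => ?_, fun i => by simp⟩
  simpa using hg hij

theorem strictMono_cases {r N : ℕ} (g : Fin r → Fin (N+1)) (hg : StrictMono g) :
    (∃ g' : Fin r → Fin N, StrictMono g' ∧ ∀ i, g i = (g' i).succ) ∨
    (∃ r', ∃ e : r = r' + 1, ∃ g' : Fin r' → Fin N, StrictMono g' ∧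
      g (Fin.cast e.symm 0) = 0 ∧ ∀ i : Fin r', g (Fin.cast e.symm i.succ) = (g' i).succ) := by
  by_cases h : ∀ i, g i ≠ 0
  · exact Or.inl (strictMono_pred g hg h)
  · right
    push Not at h
    obtain ⟨i, hi⟩ := h
    cases r with
    | zero => exact i.elim0
    | succ r' =>
      have h0 : g 0 = 0 := by
        have : g 0 ≤ g i := hg.monotone (Fin.zero_le _)
        rw [hi] at this
        exact Fin.le_zero_iff.1 this
      obtain ⟨g', hg', e⟩ := strictMono_pred (fun i : Fin r' => g i.succ)
        (fun i j hij => hg (by simpa using hij)) (fun i => by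
          have : g 0 < g i.succ := hg (Fin.succ_pos i)
          rw [h0] at this
          exact this.ne')
      exact ⟨r', rfl, g', hg', by simpa using h0, fun i => by simpa using e i⟩

theorem VV_tendsto {N : ℕ} : ∀ {r : ℕ} (g : Fin r → Fin N), StrictMono g →
    Tendsto (fun t : Fin N → ℕ => t ∘ g) (VV N) (VV r) := by
  induction N with
  | zero =>
    intro r g hg
    cases r with
    | zero =>
      intro S hS
      have h := (VV_zero (P := (· ∈ S))).1 hS
      exact Eventually.of_forall fun t => h _
    | succ r => exact (g 0).elim0
  | succ N ih =>
    intro r g hg S hS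
    rcases strictMono_cases g hg with ⟨g', hg', e⟩ | ⟨r', rfl, g', hg', e0, e⟩
    · change ∀ᶠ t in (VV (N+1) : Filter (Fin (N+1) → ℕ)), t ∘ g ∈ S
      rw [VV_succ]
      refine Eventually.of_forall fun n => ?_
      have := ih g' hg' hS
      filter_upwards [this] with t ht
      have h2 : (Fin.cons n t : Fin (N+1) → ℕ) ∘ g = t ∘ g' := by
        funext i
        simp [e]
      rw [h2]
      exact ht
    · change ∀ᶠ t in (VV (N+1) : Filter (Fin (N+1) → ℕ)), t ∘ g ∈ S
      rw [VV_succ]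
      have hS' := (VV_succ (P := (· ∈ S))).1 hS
      filter_upwards [hS'] with n hn
      have := (ih g' hg').eventually hn
      filter_upwards [this] with t ht
      convert ht using 1
      funext i
      refine Fin.cases ?_ (fun i => ?_) i
      · simpa using congrArg (Fin.cons n t : Fin (N+1) → ℕ) e0
      · simpa using congrArg (Fin.cons n t : Fin (N+1) → ℕ) (e i)

/-- A requirement: a length and a set of tuples of that length. -/
def Req := Σ N : ℕ, Set (Fin N → ℕ)

/-- The section of a requirement at `a`. -/
def Req.sec (a : ℕ) : Req → Req
  | ⟨0, B⟩ => ⟨0, B⟩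
  | ⟨N + 1, B⟩ => ⟨N, {t | (Fin.cons a t : Fin (N+1) → ℕ) ∈ B}⟩

/-- The requirement is large. -/
def Req.Large (r : Req) : Prop := r.2 ∈ VV r.1

theorem Req.sec_large (r : Req) (hr : r.Large) :
    ∀ᶠ a in (hyperfilter ℕ : Filter ℕ), (r.sec a).Large := by
  obtain ⟨N, B⟩ := r
  cases N with
  | zero => exact Eventually.of_forall fun a => hr
  | succ N => exact (VV_succ (P := (· ∈ B))).1 hr

theorem exists_next (R : Set Req) (hR : R.Finite) (hL : ∀ r ∈ R, r.Large) (b : ℕ) :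
    ∃ a, b ≤ a ∧ ∀ r ∈ R, (r.sec a).Large := by
  have h1 : ∀ᶠ a in (hyperfilter ℕ : Filter ℕ), ∀ r ∈ R, (r.sec a).Large :=
    (hR.eventually_all).2 fun r hr => r.sec_large (hL r hr)
  have h2 : ∀ᶠ a in (hyperfilter ℕ : Filter ℕ), b ≤ a :=
    Nat.hyperfilter_le_atTop (Ici_mem_atTop b)
  obtain ⟨a, h⟩ := (h1.and h2).exists
  exact ⟨a, h.2, h.1⟩

theorem diag_lemma (B : ℕ → Set Req) (hBf : ∀ l, (B l).Finite)
    (hB : ∀ l, ∀ r ∈ B l, r.Large) :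
    ∃ M : ℕ → ℕ, StrictMono M ∧ ∀ l, ∀ r ∈ B l, ∀ t : Fin r.1 → ℕ, StrictMono t →
      (∀ i, t i ∈ Set.range M) → (∀ i, M l ≤ t i) → t ∈ r.2 := by
  classical
  let pick : Set Req → ℕ → ℕ := fun R b =>
    if h : ∃ a, b ≤ a ∧ ∀ r ∈ R, (r.sec a).Large then h.choose else 0
  let S : ℕ → ℕ × Set Req := fun n => Nat.rec (0, B 0) (fun n s =>
    (pick s.2 s.1 + 1, (s.2 ∪ Req.sec (pick s.2 s.1) '' s.2) ∪ B (n+1))) n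
  let M : ℕ → ℕ := fun n => pick (S n).2 (S n).1
  have hS1 : ∀ n, (S (n+1)).1 = M n + 1 := fun n => rfl
  have hS2 : ∀ n, (S (n+1)).2 = ((S n).2 ∪ Req.sec (M n) '' (S n).2) ∪ B (n+1) := fun n => rfl
  have pick_spec : ∀ R b, (∃ a, b ≤ a ∧ ∀ r ∈ R, (r.sec a).Large) →
      b ≤ pick R b ∧ ∀ r ∈ R, (r.sec (pick R b)).Large := by
    intro R b h
    simp only [pick, dif_pos h]
    exact h.choose_spec
  have inv : ∀ n, (S n).2.Finite ∧ ∀ r ∈ (S n).2, r.Large := by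
    intro n
    induction n with
    | zero => exact ⟨hBf 0, hB 0⟩
    | succ n ih =>
      rw [hS2]
      refine ⟨(ih.1.union (ih.1.image _)).union (hBf _), ?_⟩
      have := pick_spec _ _ (exists_next _ ih.1 ih.2 (S n).1)
      rintro r ((hr | ⟨r, hr, rfl⟩) | hr)
      · exact ih.2 r hr
      · exact this.2 r hr
      · exact hB _ r hr
  have hM : ∀ n, (S n).1 ≤ M n := fun n =>
    (pick_spec _ _ (exists_next _ (inv n).1 (inv n).2 (S n).1)).1
  have hmono : StrictMono M := strictMono_nat_of_lt_succ fun n => by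
    have := hM (n+1); rw [hS1] at this; omega
  have hsub : ∀ n m, n ≤ m → (S n).2 ⊆ (S m).2 := by
    intro n m h
    induction m, h using Nat.le_induction with
    | base => exact subset_rfl
    | succ m _ ih =>
      refine ih.trans ?_
      rw [hS2]
      exact fun x hx => Or.inl (Or.inl hx)
  have hBS : ∀ l, B l ⊆ (S l).2 := by
    intro l
    cases l with
    | zero => exact subset_rfl
    | succ l => rw [hS2]; exact fun x hx => Or.inr hx
  have main : ∀ N (A : Set (Fin N → ℕ)) n, (⟨N, A⟩ : Req) ∈ (S n).2 → ∀ t : Fin N → ℕ,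
      StrictMono t → (∀ i, t i ∈ Set.range M) → (∀ i, M n ≤ t i) → t ∈ A := by
    intro N
    induction N with
    | zero =>
      intro A n hA t _ _ _
      exact (VV_zero (P := (· ∈ A))).1 ((inv n).2 _ hA) t
    | succ N ih =>
      intro A n hA t ht htM htn
      obtain ⟨i, hi⟩ := htM 0
      have hni : n ≤ i := by
        have := htn 0
        rw [← hi] at this
        exact hmono.le_iff_le.1 this
      have h2 : (⟨N, {u | (Fin.cons (M i) u : Fin (N+1) → ℕ) ∈ A}⟩ : Req) ∈ (S (i+1)).2 := by
        rw [hS2]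
        exact Or.inl (Or.inr ⟨⟨N+1, A⟩, hsub _ _ hni hA, rfl⟩)
      have h3 := ih _ _ h2 (fun j => t j.succ) (fun a b hab => ht (by simpa using hab))
        (fun j => htM _) (fun j => by
          obtain ⟨j', hj'⟩ := htM j.succ
          have : t 0 < t j.succ := ht (Fin.succ_pos j)
          rw [← hj', ← hi] at this
          rw [← hj']
          exact hmono.monotone (Nat.succ_le_of_lt (hmono.lt_iff_lt.1 this)))
      have h4 : (Fin.cons (M i) (fun j => t j.succ) : Fin (N+1) → ℕ) ∈ A := h3
      rw [hi] at h4
      have : (Fin.cons (t 0) (fun j => t j.succ) : Fin (N+1) → ℕ) = t := Fin.cons_self_tail t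
      rwa [this] at h4
  exact ⟨M, hmono, fun l r hr t => main r.1 r.2 l (hBS l hr) t⟩

/-- Plegma family read off from a long tuple. -/
def plg {k : ℕ} (m : ℕ) (n : Fin (k * m) → ℕ) : Fin m → Fin k → ℕ :=
  fun j i => n (finProdFinEquiv (i, j))

/-- The ultrafilter of plegma families of length `r`. -/
noncomputable def PP (k r : ℕ) : Ultrafilter (Fin r → Fin k → ℕ) := (VV (k * r)).map (plg r)

/-- Extension of a finite family to an infinite one. -/
def plgExt {k : ℕ} (m : ℕ) (n : Fin (k * m) → ℕ) : ℕ → Fin k → ℕ :=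
  fun j => if h : j < m then plg m n ⟨j, h⟩ else 0

/-- The ultrafilter of infinite plegma families. -/
noncomputable def WW (k : ℕ) : Ultrafilter (ℕ → Fin k → ℕ) :=
  (hyperfilter ℕ).bind fun m => (VV (k * m)).map (plgExt m)

theorem WW_ev {k : ℕ} {P : (ℕ → Fin k → ℕ) → Prop} :
    (∀ᶠ q in (WW k : Filter (ℕ → Fin k → ℕ)), P q) ↔
    ∀ᶠ m in (hyperfilter ℕ : Filter ℕ), ∀ᶠ n in (VV (k * m) : Filter (Fin (k * m) → ℕ)),
      P (plgExt m n) := Iff.rfl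

theorem lex_lt {k m : ℕ} {i i' : Fin k} {j j' : Fin m} :
    finProdFinEquiv (i, j) < finProdFinEquiv (i', j') ↔ i < i' ∨ (i = i' ∧ j < j') := by
  rw [Fin.lt_def, Fin.lt_def, Fin.lt_def, Fin.ext_iff]
  simp only [finProdFinEquiv_apply_val]
  have hj := j.2
  have hj' := j'.2
  constructor
  · intro h
    by_contra hcon
    push Not at hcon
    rcases Nat.lt_or_ge i' i with h1 | h1
    · have : m * (i' + 1) ≤ m * i := Nat.mul_le_mul_left _ h1
      rw [Nat.mul_add] at this
      omega
    · have e : (i : ℕ) = i' := le_antisymm h1 hcon.1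
      have := hcon.2 e
      rw [e] at h
      omega
  · rintro (h | ⟨h, h2⟩)
    · have : m * (i + 1) ≤ m * i' := Nat.mul_le_mul_left _ h
      rw [Nat.mul_add] at this
      omega
    · rw [h]; omega

theorem WW_map {k r : ℕ} (f : Fin r → ℕ) (hf : StrictMono f) :
    (WW k).map (fun q => q ∘ f) = PP k r := by
  apply Ultrafilter.eq_of_le
  intro S hS
  have hS' : ∀ᶠ n in (VV (k * r) : Filter (Fin (k * r) → ℕ)), plg r n ∈ S := hS
  change ∀ᶠ q in (WW k : Filter (ℕ → Fin k → ℕ)), q ∘ f ∈ S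
  rw [WW_ev]
  obtain ⟨b, hb⟩ : ∃ b, ∀ i, f i < b := by
    refine ⟨Finset.univ.sup f + 1, fun i => ?_⟩
    have := Finset.le_sup (f := f) (Finset.mem_univ i)
    omega
  filter_upwards [Nat.hyperfilter_le_atTop (Ici_mem_atTop b)] with m hm
  have hm' : ∀ i, f i < m := fun i => (hb i).trans_le hm
  let g : Fin (k * r) → Fin (k * m) := fun c =>
    finProdFinEquiv ((finProdFinEquiv.symm c).1, ⟨f (finProdFinEquiv.symm c).2, hm' _⟩)
  have hg : StrictMono g := by
    intro c d hcd
    obtain ⟨⟨i, j⟩, rfl⟩ := finProdFinEquiv.surjective c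
    obtain ⟨⟨i', j'⟩, rfl⟩ := finProdFinEquiv.surjective d
    simp only [g, Equiv.symm_apply_apply]
    rw [lex_lt] at hcd ⊢
    rcases hcd with h | ⟨h, h2⟩
    · exact Or.inl h
    · exact Or.inr ⟨h, hf h2⟩
  have := (VV_tendsto g hg).eventually hS'
  filter_upwards [this] with n hn
  convert hn using 1
  funext j i
  simp only [plgExt, plg, g, Function.comp_apply, dif_pos (hm' j), Equiv.symm_apply_apply]

section Normed

variable {X : Type*} [NormedAddCommGroup X] [NormedSpace ℝ X]

/-- Weak limit along an ultrafilter. -/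
def WLim {α : Type} (V : Ultrafilter α) (y : α → X) (z : X) : Prop :=
  ∀ f : StrongDual ℝ X, Tendsto (fun a => f (y a)) V (𝓝 (f z))

/-- Every ultrafilter on `K` has a weak limit. -/
def WC (K : Set X) : Prop :=
  ∀ (α : Type) (V : Ultrafilter α) (y : α → X), (∀ a, y a ∈ K) → ∃ z, WLim V y z

theorem WC.translate {K : Set X} (hK : WC K) (x₀ : X) : WC {v | v + x₀ ∈ K} := by
  intro α V y hy
  obtain ⟨z, hz⟩ := hK α V (fun a => y a + x₀) hy
  refine ⟨z - x₀, fun f => ?_⟩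
  have := (hz f).sub_const (f x₀)
  simpa using this

theorem wlim_mem {α : Type} {V : Ultrafilter α} {y : α → X} {z : X} (h : WLim V y z)
    {A : Set X} (hc : Convex ℝ A) (hcl : IsClosed A)
    (hA : ∀ᶠ a in (V : Filter α), y a ∈ A) : z ∈ A := by
  by_contra hz
  obtain ⟨f, u, h1, h2⟩ := geometric_hahn_banach_closed_point hc hcl hz
  have h3 : f z ≤ u := le_of_tendsto (h f) (hA.mono fun a ha => (h1 _ ha).le)
  linarith

theorem wlim_cons {k : ℕ} {y : (Fin (k+1) → ℕ) → X} {z : X} (h : WLim (VV (k+1)) y z)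
    {zz : ℕ → X} (hz : ∀ n, WLim (VV k) (fun t => y (Fin.cons n t)) (zz n)) :
    WLim (hyperfilter ℕ) zz z := by
  intro f
  rw [Metric.tendsto_nhds]
  intro ε hε
  have h1 := (Metric.tendsto_nhds.1 (h f)) (ε/2) (by positivity)
  rw [VV_succ] at h1
  filter_upwards [h1] with n hn
  have h2 : dist (f (zz n)) (f z) ≤ ε / 2 :=
    le_of_tendsto ((hz n f).dist tendsto_const_nhds) (hn.mono fun a ha => ha.le)
  linarith

theorem levelset_convex {α : Type} (V : Ultrafilter α) (b : α → X) (s : ℝ) (c : ℝ) :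
    Convex ℝ {v : X | ∀ c' > c, ∀ᶠ n in (V : Filter α), ‖b n + s • v‖ ≤ c'} := by
  intro v hv w hw p q hp hq hpq c' hc'
  filter_upwards [hv c' hc', hw c' hc'] with n h1 h2
  have e : b n + s • (p • v + q • w) = p • (b n + s • v) + q • (b n + s • w) := by
    calc b n + s • (p • v + q • w) = (p + q) • b n + s • (p • v + q • w) := by
          rw [hpq, one_smul]
      _ = _ := by module
  rw [e]
  calc _ ≤ ‖p • (b n + s • v)‖ + ‖q • (b n + s • w)‖ := norm_add_le _ _
    _ = p * ‖b n + s • v‖ + q * ‖b n + s • w‖ := by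
      rw [norm_smul, norm_smul, Real.norm_of_nonneg hp, Real.norm_of_nonneg hq]
    _ ≤ p * c' + q * c' := by gcongr
    _ = c' := by rw [← add_mul, hpq, one_mul]

theorem levelset_closed {α : Type} (V : Ultrafilter α) (b : α → X) (s : ℝ) (c : ℝ) :
    IsClosed {v : X | ∀ c' > c, ∀ᶠ n in (V : Filter α), ‖b n + s • v‖ ≤ c'} := by
  rw [← closure_subset_iff_isClosed]
  intro v hv c' hc'
  have hpos : 0 < (c' - c) / 2 / (|s| + 1) := by
    have : 0 < c' - c := by linarith
    positivity
  obtain ⟨w, hw, hd⟩ := Metric.mem_closure_iff.1 hv _ hpos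
  have h1 := hw ((c + c') / 2) (by linarith)
  filter_upwards [h1] with n hn
  have e : b n + s • v = (b n + s • w) + s • (v - w) := by module
  rw [e]
  have h2 : ‖s • (v - w)‖ ≤ (c' - c) / 2 := by
    rw [norm_smul, ← dist_eq_norm, Real.norm_eq_abs]
    calc |s| * dist v w ≤ (|s| + 1) * ((c' - c) / 2 / (|s| + 1)) := by
          gcongr
          linarith
      _ = _ := by field_simp
  calc _ ≤ ‖b n + s • w‖ + ‖s • (v - w)‖ := norm_add_le _ _
    _ ≤ c' := by linarith

theorem supp_core {K : Set X} (hK : WC K) (s : ℝ) : ∀ (N k : ℕ) (g : Fin k → Fin N),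
    StrictMono g → ∀ (b : (Fin N → ℕ) → X),
    (∀ n n', (∀ i, i ∉ Set.range g → n i = n' i) → b n = b n') →
    ∀ (y : (Fin k → ℕ) → X), (∀ t, y t ∈ K) → ∀ z, WLim (VV k) y z → ∀ c,
    (∀ᶠ n in (VV N : Filter (Fin N → ℕ)), ‖b n + s • y (n ∘ g)‖ ≤ c) → ∀ c' > c,
    ∀ᶠ n in (VV N : Filter (Fin N → ℕ)), ‖b n + s • z‖ ≤ c' := by
  intro N
  induction N with
  | zero =>
    intro k g hg b hb y hy z hz c h c' hc'
    cases k with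
    | succ k => exact (g 0).elim0
    | zero =>
      have : z ∈ ({y (fun i => i.elim0)} : Set X) := by
        refine wlim_mem hz (convex_singleton _) isClosed_singleton ?_
        rw [VV_zero]
        intro t
        rw [Set.mem_singleton_iff]
        congr 1
        funext i
        exact i.elim0
      rw [Set.mem_singleton_iff] at this
      filter_upwards [h] with n hn
      have e : n ∘ g = fun i => i.elim0 := by
        funext i; exact i.elim0
      rw [e, ← this] at hn
      linarith
  | succ N ih =>
    intro k g hg b hb y hy z hz c h c' hc'
    rw [VV_succ] at h ⊢
    rcases strictMono_cases g hg with ⟨g', hg', e⟩ | ⟨k', rfl, g', hg', e0, e⟩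
    · filter_upwards [h] with n0 hn0
      refine ih k g' hg' (fun n => b (Fin.cons n0 n)) ?_ y hy z hz c ?_ c' hc'
      · intro n n' hn
        apply hb
        intro i
        refine Fin.cases (fun _ => by simp) (fun i hi => ?_) i
        simp only [Fin.cons_succ]
        apply hn
        rintro ⟨j, rfl⟩
        exact hi ⟨j, e j⟩
      · filter_upwards [hn0] with n hn
        have e2 : (Fin.cons n0 n : Fin (N+1) → ℕ) ∘ g = n ∘ g' := by
          funext i; simp [e]
        rwa [e2] at hn
    · choose zz hzz using fun n0 : ℕ => hK _ (VV k') (fun t => y (Fin.cons n0 t)) (fun t => hy _)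
      have hzlim := wlim_cons hz hzz
      have hb0 : ∀ n0 n, b (Fin.cons n0 n) = b (Fin.cons 0 n) := by
        intro n0 n
        apply hb
        intro i
        refine Fin.cases (fun h => ?_) (fun i _ => by simp) i
        exact absurd ⟨_, e0⟩ h
      have hmem := wlim_mem hzlim (levelset_convex (VV N) (fun n => b (Fin.cons 0 n)) s c)
        (levelset_closed (VV N) (fun n => b (Fin.cons 0 n)) s c) (by
          filter_upwards [h] with n0 hn0
          intro c' hc'
          refine ih k' g' hg' (fun n => b (Fin.cons 0 n)) ?_ (fun t => y (Fin.cons n0 t))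
            (fun t => hy _) (zz n0) (hzz n0) c ?_ c' hc'
          · intro n n' hn
            apply hb
            intro i
            refine Fin.cases (fun _ => by simp) (fun i hi => ?_) i
            simp only [Fin.cons_succ]
            apply hn
            rintro ⟨j, rfl⟩
            exact hi ⟨_, e j⟩
          · filter_upwards [hn0] with n hn
            have e2 : (Fin.cons n0 n : Fin (N+1) → ℕ) ∘ g = Fin.cons n0 (n ∘ g') := by
              funext i
              refine Fin.cases ?_ (fun i => ?_) i
              · simpa using congrArg (Fin.cons n0 n : Fin (N+1) → ℕ) e0
              · simpa using congrArg (Fin.cons n0 n : Fin (N+1) → ℕ) (e i)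
            rwa [e2, hb0] at hn)
      refine Eventually.of_forall fun n0 => ?_
      simp only [hb0 n0]
      exact hmem c' hc'

theorem exists_ulim {α : Type} (V : Ultrafilter α) (f : α → ℝ) (C : ℝ) (h : ∀ a, |f a| ≤ C) :
    ∃ r, Tendsto f V (𝓝 r) := by
  have hc : IsCompact (Set.Icc (-C) C) := isCompact_Icc
  obtain ⟨r, _, hr⟩ := hc.ultrafilter_le_nhds (V.map f) (by
    rw [le_principal_iff]
    change ∀ᶠ a in (V : Filter α), f a ∈ Set.Icc (-C) C
    exact Eventually.of_forall fun a => abs_le.1 (h a))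
  exact ⟨r, hr⟩

/-- `ρ` is the spreading model seminorm of `w`. -/
def IsSM {k : ℕ} (w : (Fin k → ℕ) → X) (ρ : Seminorm ℝ (ℕ →₀ ℝ)) : Prop :=
  ∀ a : ℕ →₀ ℝ, Tendsto (fun q : ℕ → Fin k → ℕ =>
    ‖Finsupp.linearCombination ℝ (fun j => w (q j)) a‖) (WW k) (𝓝 (ρ a))

theorem exists_SM {k : ℕ} (w : (Fin k → ℕ) → X) (C : ℝ) (hw : ∀ s, ‖w s‖ ≤ C) :
    ∃ ρ, IsSM w ρ := by
  have h : ∀ a : ℕ →₀ ℝ, ∃ r, Tendsto (fun q : ℕ → Fin k → ℕ =>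
    ‖Finsupp.linearCombination ℝ (fun j => w (q j)) a‖) (WW k) (𝓝 r) := by
    intro a
    apply exists_ulim _ _ (a.sum fun _ c => |c| * C)
    intro q
    rw [abs_of_nonneg (norm_nonneg _), Finsupp.linearCombination_apply]
    refine (norm_sum_le _ _).trans (Finset.sum_le_sum fun j _ => ?_)
    simp only [norm_smul, Real.norm_eq_abs]
    gcongr
    exact hw _
  choose ρ hρ using h
  refine ⟨Seminorm.of ρ ?_ ?_, hρ⟩
  · intro a b
    refine le_of_tendsto_of_tendsto' (hρ (a + b)) ((hρ a).add (hρ b)) fun q => ?_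
    rw [map_add]
    exact norm_add_le _ _
  · intro c a
    refine tendsto_nhds_unique (hρ (c • a)) ?_
    have := (hρ a).const_mul ‖c‖
    simpa [norm_smul] using this

theorem IsSM.fin {k : ℕ} {w : (Fin k → ℕ) → X} {ρ} (h : IsSM w ρ) {r : ℕ} (a : Fin r → ℝ)
    (f : Fin r → ℕ) (hf : StrictMono f) :
    Tendsto (fun p : Fin r → Fin k → ℕ => ‖∑ i, a i • w (p i)‖) (PP k r)
      (𝓝 (ρ (∑ i, a i • Finsupp.single (f i) (1 : ℝ)))) := by
  rw [← WW_map f hf, Ultrafilter.coe_map, tendsto_map'_iff]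
  convert h _ using 1
  funext q
  simp [map_sum]

theorem IsSM.fin' {k : ℕ} {w : (Fin k → ℕ) → X} {ρ} (h : IsSM w ρ) {r : ℕ} (a : Fin r → ℝ) :
    Tendsto (fun p : Fin r → Fin k → ℕ => ‖∑ i, a i • w (p i)‖) (PP k r)
      (𝓝 (ρ (∑ i, a i • Finsupp.single (i : ℕ) (1 : ℝ)))) :=
  h.fin a (fun i => (i : ℕ)) (fun _ _ h => h)

theorem IsSM.spreading {k : ℕ} {w : (Fin k → ℕ) → X} {ρ} (h : IsSM w ρ) :
    IsSpreadingWith ρ (fun n => Finsupp.single n (1 : ℝ)) := by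
  intro n a f hf
  exact tendsto_nhds_unique (h.fin' a) (h.fin a f hf)

theorem IsSM.upper {k : ℕ} {w : (Fin k → ℕ) → X} {ρ} (h : IsSM w ρ) {C : ℝ}
    (hw : ∀ s, ‖w s‖ ≤ C) (n : ℕ) (a : Fin n → ℝ) :
    ρ (∑ i, a i • Finsupp.single (i : ℕ) (1 : ℝ)) ≤ C * ∑ i, |a i| := by
  refine le_of_tendsto' (h.fin' a) fun p => ?_
  refine (norm_sum_le _ _).trans ?_
  rw [Finset.mul_sum]
  refine Finset.sum_le_sum fun j _ => ?_
  rw [norm_smul, Real.norm_eq_abs, mul_comm]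
  gcongr
  exact hw _

theorem IsSM.suppress {k : ℕ} {w : (Fin k → ℕ) → X} {ρ} (h : IsSM w ρ)
    {K : Set X} (hK : WC K) (hw : ∀ s, w s ∈ K) (h0 : WLim (VV k) w 0)
    {n : ℕ} (a : Fin n → ℝ) (j : Fin n) :
    ρ (∑ i, (if i = j then 0 else a i) • Finsupp.single (i : ℕ) (1 : ℝ)) ≤
      ρ (∑ i, a i • Finsupp.single (i : ℕ) (1 : ℝ)) := by
  set A := ρ (∑ i, a i • Finsupp.single (i : ℕ) (1 : ℝ)) with hA
  apply le_of_forall_gt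
  intro c hc
  obtain ⟨c1, hc1, hc1'⟩ := exists_between hc
  obtain ⟨c2, hc2, hc2'⟩ := exists_between hc1'
  have h1 : ∀ᶠ m in (VV (k * n) : Filter (Fin (k * n) → ℕ)),
      ‖∑ i, a i • w (plg n m i)‖ ≤ c1 := by
    have := (h.fin' a).eventually (gt_mem_nhds hc1)
    exact this.mono fun _ h => h.le
  have h2 := supp_core hK (a j) (k * n) k (fun i => finProdFinEquiv (i, j))
    (fun i i' hii => lex_lt.2 (Or.inl hii))
    (fun m => ∑ i, (if i = j then 0 else a i) • w (plg n m i)) (by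
      intro m m' hm
      refine Finset.sum_congr rfl fun i _ => ?_
      by_cases hij : i = j
      · simp [hij]
      · congr 2
        funext i'
        apply hm
        rintro ⟨i'', e⟩
        have := finProdFinEquiv.injective e
        simp only [Prod.mk.injEq] at this
        exact hij this.2.symm) w hw 0 h0 c1 (by
      filter_upwards [h1] with m hm
      convert hm using 2
      have e : (m ∘ fun i => finProdFinEquiv (i, j)) = plg n m j := rfl
      rw [e, ← Finset.add_sum_erase _ _ (Finset.mem_univ j),
        ← Finset.add_sum_erase (Finset.univ) (fun i => a i • w (plg n m i)) (Finset.mem_univ j)]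
      simp only [if_true, zero_smul, zero_add]
      rw [add_comm]
      congr 1
      refine Finset.sum_congr rfl fun i hi => ?_
      rw [if_neg (Finset.ne_of_mem_erase hi)]) c2 hc2
  refine lt_of_le_of_lt (le_of_tendsto (h.fin' _) ?_) hc2'
  have h3 : ∀ᶠ m in (VV (k * n) : Filter (Fin (k * n) → ℕ)),
      ‖∑ i, (if i = j then 0 else a i) • w (plg n m i)‖ ≤ c2 := by
    simpa only [smul_zero, add_zero] using h2
  exact h3

theorem IsSM.suppressSet {k : ℕ} {w : (Fin k → ℕ) → X} {ρ} (h : IsSM w ρ)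
    {K : Set X} (hK : WC K) (hw : ∀ s, w s ∈ K) (h0 : WLim (VV k) w 0)
    {n : ℕ} (a : Fin n → ℝ) (F : Finset (Fin n)) :
    ρ (∑ i, (if i ∈ F then 0 else a i) • Finsupp.single (i : ℕ) (1 : ℝ)) ≤
      ρ (∑ i, a i • Finsupp.single (i : ℕ) (1 : ℝ)) := by
  classical
  induction F using Finset.induction_on with
  | empty => simp
  | insert j F hj ih =>
    refine le_trans (le_of_eq ?_)
      ((h.suppress hK hw h0 (fun i => if i ∈ F then 0 else a i) j).trans ih)
    congr 1
    refine Finset.sum_congr rfl fun i _ => ?_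
    by_cases h1 : i = j <;> by_cases h2 : i ∈ F <;> simp [h1, h2]

theorem IsSM.weakLower {k : ℕ} {w : (Fin k → ℕ) → X} {ρ} (h : IsSM w ρ) {z : X}
    (hz : WLim (VV k) w z) {n : ℕ} (a : Fin n → ℝ) :
    |∑ i, a i| * ‖z‖ ≤ ρ (∑ i, a i • Finsupp.single (i : ℕ) (1 : ℝ)) := by
  have hlim : WLim (PP k n) (fun p : Fin n → Fin k → ℕ => ∑ i, a i • w (p i))
      ((∑ i, a i) • z) := by
    intro f
    simp only [map_sum, map_smul, Finset.sum_smul]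
    refine tendsto_finsetSum _ fun i _ => ?_
    refine Tendsto.const_smul ?_ _
    have ht : Tendsto (fun p : Fin n → Fin k → ℕ => p i) (PP k n) (VV k) := by
      rw [PP, Ultrafilter.coe_map, tendsto_map'_iff]
      exact VV_tendsto (fun i' : Fin k => finProdFinEquiv (i', i))
        (fun i i' hii => lex_lt.2 (Or.inl hii))
    exact (hz f).comp ht
  have e : |∑ i, a i| * ‖z‖ = ‖(∑ i, a i) • z‖ := by rw [norm_smul, Real.norm_eq_abs]
  rw [e]
  apply le_of_forall_gt
  intro c hc
  obtain ⟨c1, hc1, hc1'⟩ := exists_between hc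
  have := wlim_mem hlim (convex_closedBall (0 : X) c1) Metric.isClosed_closedBall (by
    have := (h.fin' a).eventually (gt_mem_nhds hc1)
    exact this.mono fun _ h => by simpa using h.le)
  rw [mem_closedBall_zero_iff] at this
  linarith

/-- Uniform closeness over all coefficients. -/
theorem IsSM.uniform {k : ℕ} {w : (Fin k → ℕ) → X} {ρ} (h : IsSM w ρ) {C : ℝ}
    (hw : ∀ s, ‖w s‖ ≤ C) (n : ℕ) (ε : ℝ) (hε : 0 < ε) :
    ∀ᶠ p in (PP k n : Filter (Fin n → Fin k → ℕ)), ∀ a : Fin n → ℝ,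
      (∀ j, a j ∈ Set.Icc (-1 : ℝ) 1) →
      |‖∑ j, a j • w (p j)‖ - ρ (∑ j, a j • Finsupp.single (j : ℕ) (1 : ℝ))| ≤ ε := by
  have hC : 0 ≤ C := (norm_nonneg _).trans (hw 0)
  have hcomp : IsCompact (Set.pi Set.univ fun _ : Fin n => Set.Icc (-1 : ℝ) 1) :=
    isCompact_univ_pi fun _ => isCompact_Icc
  obtain ⟨η, hη, hη'⟩ : ∃ η > 0, C * (n * η) ≤ ε / 3 := by
    refine ⟨ε / 3 / (C * n + 1), by positivity, ?_⟩
    calc C * (n * (ε / 3 / (C * n + 1))) = (ε / 3) * ((C * n) / (C * n + 1)) := by ring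
      _ ≤ (ε / 3) * 1 := by
        gcongr
        rw [div_le_one (by positivity)]
        linarith
      _ = _ := by ring
  have key : ∀ a : Fin n → ℝ, ∀ᶠ p in (PP k n : Filter (Fin n → Fin k → ℕ)),
      ∀ a' ∈ Metric.ball a η,
      |‖∑ j, a' j • w (p j)‖ - ρ (∑ j, a' j • Finsupp.single (j : ℕ) (1 : ℝ))| ≤ ε := by
    intro a
    have h1 := (Metric.tendsto_nhds.1 (h.fin' a)) (ε / 3) (by positivity)
    filter_upwards [h1] with p hp a' ha'
    rw [Real.dist_eq] at hp
    have hs : ∑ i, |a' i - a i| ≤ n * η := by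
      calc ∑ i, |a' i - a i| ≤ ∑ _i : Fin n, η := by
            refine Finset.sum_le_sum fun i _ => ?_
            rw [← Real.dist_eq]
            exact (dist_le_pi_dist a' a i).trans (Metric.mem_ball.1 ha').le
        _ = n * η := by simp
    have hs' : C * ∑ i, |a' i - a i| ≤ ε / 3 :=
      (mul_le_mul_of_nonneg_left hs hC).trans hη'
    have h2 : |‖∑ j, a' j • w (p j)‖ - ‖∑ j, a j • w (p j)‖| ≤ ε / 3 := by
      refine (abs_norm_sub_norm_le _ _).trans (le_trans ?_ hs')
      rw [← Finset.sum_sub_distrib, Finset.mul_sum]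
      refine (norm_sum_le _ _).trans (Finset.sum_le_sum fun j _ => ?_)
      rw [← sub_smul, norm_smul, Real.norm_eq_abs, mul_comm]
      gcongr
      exact hw _
    have h3 : |ρ (∑ j, a' j • Finsupp.single (j : ℕ) (1 : ℝ)) -
        ρ (∑ j, a j • Finsupp.single (j : ℕ) (1 : ℝ))| ≤ ε / 3 := by
      refine (abs_sub_map_le_sub ρ _ _).trans (le_trans ?_ hs')
      rw [← Finset.sum_sub_distrib]
      simp only [← sub_smul]
      exact h.upper hw n (fun i => a' i - a i)
    rw [abs_le] at h2 h3 ⊢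
    rw [abs_lt] at hp
    constructor <;> linarith [h2.1, h2.2, h3.1, h3.2, hp.1, hp.2]
  obtain ⟨T, hT, hcov⟩ := hcomp.elim_nhds_subcover (fun a => Metric.ball a η)
    (fun a _ => Metric.ball_mem_nhds a hη)
  have := (T.eventually_all).2 fun a _ => key a
  filter_upwards [this] with p hp a ha
  have := hcov (show a ∈ _ from fun j _ => ha j)
  simp only [Set.mem_iUnion] at this
  obtain ⟨a0, h0, h1⟩ := this
  exact hp a0 h0 a h1

theorem plegma_strictMono {M : Set ℕ} {k m : ℕ} {p : Fin m → Fin k → ℕ} (hp : IsPlegma M p) :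
    StrictMono (fun c : Fin (k * m) =>
      p (finProdFinEquiv.symm c).2 (finProdFinEquiv.symm c).1) := by
  intro c d hcd
  obtain ⟨⟨i, j⟩, rfl⟩ := finProdFinEquiv.surjective c
  obtain ⟨⟨i', j'⟩, rfl⟩ := finProdFinEquiv.surjective d
  simp only [Equiv.symm_apply_apply]
  rcases lex_lt.1 hcd with h | ⟨rfl, h⟩
  · have h1 : (i : ℕ) + 1 < k := lt_of_le_of_lt (Nat.succ_le_of_lt h) i'.2
    refine (hp.2.2 i h1 j j').trans_le ((hp.1 j').1.monotone ?_)
    rw [Fin.le_def]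
    exact h
  · exact hp.2.1 i h

theorem IsSM.generates {k : ℕ} {w : (Fin k → ℕ) → X} {ρ} (h : IsSM w ρ) {C : ℝ}
    (hw : ∀ s, ‖w s‖ ≤ C) :
    ∃ M : ℕ → ℕ, StrictMono M ∧
      Generates ρ w M (fun n => Finsupp.single n (1 : ℝ)) (fun l => 1 / ((l : ℝ) + 1)) := by
  let R : ℕ → ℕ → Req := fun l m => ⟨k * (m + 1), {n | ∀ a : Fin (m+1) → ℝ,
      (∀ j, a j ∈ Set.Icc (-1 : ℝ) 1) →
      |‖∑ j, a j • w (plg (m+1) n j)‖ - ρ (∑ j, a j • Finsupp.single (j : ℕ) (1 : ℝ))|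
        ≤ 1 / ((l : ℝ) + 1)}⟩
  obtain ⟨M, hM, hM2⟩ := diag_lemma (fun l => (R l) '' Set.Iic l)
    (fun l => (Set.finite_Iic l).image _) (by
      rintro l _ ⟨m, _, rfl⟩
      exact h.uniform hw (m+1) (1 / ((l : ℝ) + 1)) (by positivity))
  refine ⟨M, hM, ?_⟩
  intro m l hml p hp hpl a ha
  have := hM2 l (R l m) ⟨m, hml, rfl⟩ _ (plegma_strictMono hp)
    (fun c => (hp.1 _).2 _) (fun c => hpl _ _) a ha
  have e : plg (m+1) (fun c : Fin (k * (m+1)) =>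
      p (finProdFinEquiv.symm c).2 (finProdFinEquiv.symm c).1) = p := by
    funext j i
    simp only [plg, Equiv.symm_apply_apply]
  rw [e] at this
  exact this

theorem nullpos : IsNullPos (fun l : ℕ => 1 / ((l : ℝ) + 1)) :=
  ⟨fun l => by positivity, tendsto_one_div_add_atTop_nhds_zero_nat⟩

theorem seminorm_sum_le {ι : Type*} (ρ : Seminorm ℝ (ℕ →₀ ℝ)) (s : Finset ι)
    (f : ι → (ℕ →₀ ℝ)) : ρ (∑ i ∈ s, f i) ≤ ∑ i ∈ s, ρ (f i) :=
  Finset.le_sum_of_subadditive ρ (map_zero ρ).le (map_add_le_add ρ) s f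

theorem lowerL1_pos (ρ : Seminorm ℝ (ℕ →₀ ℝ))
    (hs : IsSpreadingWith ρ (fun n => Finsupp.single n (1 : ℝ))) (C : ℝ)
    (hC : ∀ n, ρ (Finsupp.single n 1) ≤ C) (c : ℝ)
    (h : ∀ m : ℕ, c * m ≤ ρ (∑ j ∈ Finset.range m, Finsupp.single j 1)) (n : ℕ)
    (a : Fin n → ℝ) (ha : ∀ i, 0 ≤ a i) :
    c * ∑ i, a i ≤ ρ (∑ i, a i • Finsupp.single (i : ℕ) (1 : ℝ)) := by
  set e : ℕ → (ℕ →₀ ℝ) := fun n => Finsupp.single n 1 with he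
  set A := ρ (∑ i, a i • e (i : ℕ)) with hA
  have hsh : ∀ r : ℕ, ρ (∑ i, a i • e ((i : ℕ) + r)) = A := by
    intro r
    exact (hs n a (fun i => (i : ℕ) + r) (fun i j hij => by
      simpa using hij)).symm
  have hstep : ∀ (R i : ℕ), ρ (∑ r ∈ Finset.range R, e r - ∑ r ∈ Finset.range R, e (i + r))
      ≤ 2 * C * i := by
    intro R i
    induction i with
    | zero => simp
    | succ i ih =>
      have e1 : ∑ r ∈ Finset.range R, e r - ∑ r ∈ Finset.range R, e (i + 1 + r) =
          (∑ r ∈ Finset.range R, e r - ∑ r ∈ Finset.range R, e (i + r)) + (e i - e (i + R)) := by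
        have := Finset.sum_range_sub' (fun r => e (i + r)) R
        simp only [add_zero] at this
        rw [← this, Finset.sum_sub_distrib]
        have : ∀ r, i + 1 + r = i + (r + 1) := fun r => by ring
        simp only [this]
        abel
      rw [e1]
      refine (map_add_le_add ρ _ _).trans ?_
      have : ρ (e i - e (i + R)) ≤ C + C :=
        (map_sub_le_add ρ _ _).trans (add_le_add (hC _) (hC _))
      push_cast
      linarith
  have hbig : ∀ R : ℕ, c * R * (∑ i, a i) - ∑ i, a i * (2 * C * (i : ℕ)) ≤ R * A := by
    intro R
    have h1 : ρ (∑ r ∈ Finset.range R, ∑ i, a i • e ((i : ℕ) + r)) ≤ R * A := by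
      calc _ ≤ ∑ r ∈ Finset.range R, ρ (∑ i, a i • e ((i : ℕ) + r)) := seminorm_sum_le ρ _ _
        _ = R * A := by simp [hsh]
    have h2 : (∑ i, a i) • ∑ r ∈ Finset.range R, e r =
        (∑ r ∈ Finset.range R, ∑ i, a i • e ((i : ℕ) + r)) +
        ∑ i, a i • (∑ r ∈ Finset.range R, e r - ∑ r ∈ Finset.range R, e ((i : ℕ) + r)) := by
      rw [Finset.sum_comm, Finset.sum_smul, ← Finset.sum_add_distrib]
      refine Finset.sum_congr rfl fun i _ => ?_
      rw [← Finset.smul_sum, smul_sub]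
      abel
    have h3 : ρ ((∑ i, a i) • ∑ r ∈ Finset.range R, e r) ≤ R * A + ∑ i, a i * (2 * C * (i : ℕ)) := by
      rw [h2]
      refine (map_add_le_add ρ _ _).trans (add_le_add h1 ?_)
      refine (seminorm_sum_le ρ _ _).trans (Finset.sum_le_sum fun i _ => ?_)
      rw [map_smul_eq_mul, Real.norm_of_nonneg (ha i)]
      exact mul_le_mul_of_nonneg_left (hstep R i) (ha i)
    have hsum : 0 ≤ ∑ i, a i := Finset.sum_nonneg fun i _ => ha i
    rw [map_smul_eq_mul, Real.norm_of_nonneg hsum] at h3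
    have h4 := mul_le_mul_of_nonneg_left (h R) hsum
    have : c * R * (∑ i, a i) = (∑ i, a i) * (c * R) := by ring
    rw [this]
    linarith
  by_contra hcon
  push Not at hcon
  obtain ⟨R, hR⟩ := exists_nat_gt ((∑ i, a i * (2 * C * (i : ℕ))) / (c * ∑ i, a i - A))
  rw [div_lt_iff₀ (by linarith)] at hR
  have := hbig R
  nlinarith

theorem IsSM.lowerL1 {k : ℕ} {x : (Fin k → ℕ) → X} {ρx ρy} (hx : IsSM x ρx) {x₀ : X}
    (hlim : WLim (VV k) x x₀) (hy : IsSM (fun s => x s - x₀) ρy)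
    {K : Set X} (hK : WC K) (hxK : ∀ s, x s ∈ K) (C : ℝ) (hC : ∀ s, ‖x s - x₀‖ ≤ C)
    (c : ℝ) (h : ∀ m : ℕ, c * m ≤ ρy (∑ j ∈ Finset.range m, Finsupp.single j 1)) :
    LowerL1 ρx (fun n => Finsupp.single n (1 : ℝ)) (c / 4) := by
  have h0 : WLim (VV k) (fun s => x s - x₀) 0 := by
    intro f
    have := (hlim f).sub_const (f x₀)
    simpa using this
  have hsing : ∀ n, ρy (Finsupp.single n 1) ≤ C := by
    intro n
    have h1 := hy.upper hC 1 (fun _ => 1)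
    have h2 := hy.spreading 1 (fun _ => 1) (fun _ => n) (fun i j hij => by
      exact absurd hij (by simp [Subsingleton.elim i j]))
    rw [h2] at h1
    simpa using h1
  have hpos := lowerL1_pos ρy hy.spreading C hsing c h
  intro n a
  have hsup := hy.suppressSet (hK.translate x₀) (fun s => by simpa using hxK s) h0 a
  have hA : c * ∑ i, |a i| ≤ 2 * ρy (∑ i, a i • Finsupp.single (i : ℕ) (1 : ℝ)) := by
    have p1 := hpos n (fun i => if i ∈ Finset.univ.filter (fun i => a i < 0) then 0 else a i)
      (fun i => by
        by_cases hi : a i < 0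
        · simp [hi]
        · simp only [Finset.mem_filter, Finset.mem_univ, true_and, if_neg hi]
          exact not_lt.1 hi)
    have p2 := hpos n (fun i => - (if i ∈ Finset.univ.filter (fun i => 0 ≤ a i) then 0 else a i))
      (fun i => by
        by_cases hi : 0 ≤ a i
        · simp [hi]
        · simp [hi]; linarith)
    have e2 : ρy (∑ i, (- (if i ∈ Finset.univ.filter (fun i => 0 ≤ a i) then 0 else a i)) •
        Finsupp.single (i : ℕ) (1 : ℝ)) =
        ρy (∑ i, (if i ∈ Finset.univ.filter (fun i => 0 ≤ a i) then 0 else a i) •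
        Finsupp.single (i : ℕ) (1 : ℝ)) := by
      rw [← map_neg_eq_map, ← Finset.sum_neg_distrib]
      simp only [neg_smul, neg_neg]
    rw [e2] at p2
    have q1 := hsup (Finset.univ.filter (fun i => a i < 0))
    have q2 := hsup (Finset.univ.filter (fun i => 0 ≤ a i))
    have e3 : ∑ i, |a i| =
        ∑ i, (if i ∈ Finset.univ.filter (fun i => a i < 0) then 0 else a i) +
        ∑ i, (- (if i ∈ Finset.univ.filter (fun i => 0 ≤ a i) then 0 else a i)) := by
      rw [← Finset.sum_add_distrib]
      refine Finset.sum_congr rfl fun i _ => ?_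
      by_cases hi : 0 ≤ a i
      · simp [hi, not_lt.2 hi, abs_of_nonneg hi]
      · simp [hi, not_le.1 hi, abs_of_neg (not_le.1 hi)]
    rw [e3, mul_add]
    linarith
  have hwl := hx.weakLower hlim a
  have hdiff : ρy (∑ i, a i • Finsupp.single (i : ℕ) (1 : ℝ)) ≤
      ρx (∑ i, a i • Finsupp.single (i : ℕ) (1 : ℝ)) + |∑ i, a i| * ‖x₀‖ := by
    refine le_of_tendsto_of_tendsto' (hy.fin' a) ((hx.fin' a).add tendsto_const_nhds) fun p => ?_
    have e : ∑ i, a i • (x (p i) - x₀) = ∑ i, a i • x (p i) - (∑ i, a i) • x₀ := by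
      simp only [smul_sub, Finset.sum_sub_distrib, Finset.sum_smul]
    rw [e]
    refine (norm_sub_le _ _).trans ?_
    rw [norm_smul, Real.norm_eq_abs]
  linarith

theorem mem_kSub {k : ℕ} {F : Finset ℕ} {s : Fin k → ℕ} :
    s ∈ kSubsetEnums k F ↔ (∀ i, s i ∈ F) ∧ StrictMono s := by
  simp only [kSubsetEnums, Finset.mem_filter, Fintype.mem_piFinset]
  exact and_congr Iff.rfl ⟨fun h i j hij => h i j hij, fun h i j hij => h hij⟩

theorem card_kSub (k n : ℕ) : (kSubsetEnums k (Finset.range n)).card = n.choose k := by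
  classical
  have : (Finset.powersetCard k (Finset.range n)).card = n.choose k := by simp
  rw [← this]
  refine Finset.card_bij (fun s _ => Finset.univ.image s) ?_ ?_ ?_
  · intro s hs
    rw [mem_kSub] at hs
    rw [Finset.mem_powersetCard]
    refine ⟨?_, ?_⟩
    · intro a ha
      simp only [Finset.mem_image, Finset.mem_univ, true_and] at ha
      obtain ⟨i, rfl⟩ := ha
      exact hs.1 i
    · rw [Finset.card_image_of_injective _ hs.2.injective]
      simp
  · intro s hs t ht hst
    rw [mem_kSub] at hs ht
    refine (StrictMono.range_inj hs.2 ht.2).1 ?_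
    have := congrArg (fun F : Finset ℕ => (F : Set ℕ)) hst
    simpa using this
  · intro S hS
    rw [Finset.mem_powersetCard] at hS
    refine ⟨S.orderEmbOfFin hS.2, ?_, ?_⟩
    · rw [mem_kSub]
      exact ⟨fun i => hS.1 (Finset.orderEmbOfFin_mem _ _ _), OrderEmbedding.strictMono _⟩
    · apply Finset.coe_injective
      simp

theorem kSub_sum {k : ℕ} {L : ℕ → ℕ} (hL : StrictMono L) (n : ℕ) (x : (Fin k → ℕ) → X) :
    ∑ s ∈ kSubsetEnums k ((Finset.range n).image L), x s =
      ∑ t ∈ kSubsetEnums k (Finset.range n), x (L ∘ t) := by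
  classical
  symm
  refine Finset.sum_bij (fun t _ => L ∘ t) ?_ ?_ ?_ (fun _ _ => rfl)
  · intro t ht
    rw [mem_kSub] at ht ⊢
    exact ⟨fun i => Finset.mem_image_of_mem _ (ht.1 i), hL.comp ht.2⟩
  · intro s _ t _ h
    funext i
    exact hL.injective (congrFun h i)
  · intro s hs
    rw [mem_kSub] at hs
    have h1 := hs.1
    simp only [Finset.mem_image] at h1
    choose t ht hts using h1
    refine ⟨t, ?_, funext hts⟩
    rw [mem_kSub]
    refine ⟨ht, fun i j hij => ?_⟩
    have := hs.2 hij
    rw [← hts, ← hts] at this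
    exact hL.lt_iff_lt.1 this

theorem choose_add_le (k n q : ℕ) :
    (n + q).choose (k + 1) ≤ n.choose (k + 1) + q * (n + q).choose k := by
  induction q with
  | zero => simp
  | succ q ih =>
    have h0 : (n + q + 1).choose (k + 1) = (n + q).choose k + (n + q).choose (k + 1) :=
      Nat.choose_succ_succ _ _
    rw [← add_assoc, h0]
    have h1 : (n + q).choose k ≤ (n + q + 1).choose k := Nat.choose_le_choose _ (Nat.le_succ _)
    have h2 : q * (n + q).choose k ≤ q * (n + q + 1).choose k := Nat.mul_le_mul_left _ h1
    have h3 : (q + 1) * (n + q + 1).choose k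
      = q * (n + q + 1).choose k + (n + q + 1).choose k := by ring
    omega

theorem cesaro_bound {k : ℕ} (y : (Fin k → ℕ) → X) (C : ℝ) (hC : ∀ s, ‖y s‖ ≤ C)
    (L : ℕ → ℕ) (l m : ℕ) (hm : 0 < m) (η : ℝ)
    (hη : ∀ t : Fin k → ℕ, StrictMono t →
      ‖∑ j : Fin m, y (fun i => L (t i + l + i * m + j))‖ ≤ η * m) (n : ℕ) :
    ‖∑ t ∈ kSubsetEnums k (Finset.range (n + (l + k * m))), y (L ∘ t)‖ ≤
      C * ((n + (l + k * m)).choose k - n.choose k : ℝ) + η * n.choose k := by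
  classical
  set T := kSubsetEnums k (Finset.range (n + (l + k * m))) with hT
  set T' := kSubsetEnums k (Finset.range n) with hT'
  let φ : Fin m → (Fin k → ℕ) → (Fin k → ℕ) := fun j t i => t i + l + i * m + j
  have hφ : ∀ j, ‖∑ t ∈ T, y (L ∘ t) - ∑ t ∈ T', y (L ∘ φ j t)‖ ≤
      C * ((n + (l + k * m)).choose k - n.choose k : ℝ) := by
    intro j
    have hinj : Function.Injective (φ j) := by
      intro s t h
      funext i
      have := congrFun h i
      simp only [φ] at this
      omega
    have hsub : T'.image (φ j) ⊆ T := by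
      intro s hs
      rw [Finset.mem_image] at hs
      obtain ⟨t, ht, rfl⟩ := hs
      rw [hT', mem_kSub] at ht
      rw [hT, mem_kSub]
      refine ⟨fun i => ?_, fun i i' h => ?_⟩
      · have h1 := ht.1 i
        simp only [Finset.mem_range, φ] at h1 ⊢
        have h2 : ((i : ℕ) + 1) * m ≤ k * m := Nat.mul_le_mul_right _ i.2
        have h3 := j.2
        rw [add_mul] at h2
        omega
      · have h1 := ht.2 h
        have h2 : (i : ℕ) * m ≤ i' * m := Nat.mul_le_mul_right _ h.le
        simp only [φ]
        omega
    have e : ∑ t ∈ T', y (L ∘ φ j t) = ∑ s ∈ T'.image (φ j), y (L ∘ s) := by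
      rw [Finset.sum_image fun _ _ _ _ h => hinj h]
    rw [e, ← Finset.sum_sdiff hsub, add_sub_cancel_right]
    calc _ ≤ ∑ s ∈ T \ T'.image (φ j), ‖y (L ∘ s)‖ := norm_sum_le _ _
      _ ≤ ∑ s ∈ T \ T'.image (φ j), C := Finset.sum_le_sum fun _ _ => hC _
      _ = _ := by
        rw [Finset.sum_const, nsmul_eq_mul, Finset.cast_card_sdiff hsub,
          Finset.card_image_of_injective _ hinj, card_kSub, card_kSub, mul_comm]
  have h1 : ‖∑ j : Fin m, ∑ t ∈ T', y (L ∘ φ j t)‖ ≤ (n.choose k : ℝ) * (η * m) := by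
    rw [Finset.sum_comm]
    calc _ ≤ ∑ t ∈ T', ‖∑ j : Fin m, y (L ∘ φ j t)‖ := norm_sum_le _ _
      _ ≤ ∑ t ∈ T', η * m := Finset.sum_le_sum fun t ht => hη t (mem_kSub.1 ht).2
      _ = _ := by rw [Finset.sum_const, nsmul_eq_mul, card_kSub]
  have h2 : ‖∑ j : Fin m, (∑ t ∈ T, y (L ∘ t) - ∑ t ∈ T', y (L ∘ φ j t))‖ ≤
      m * (C * ((n + (l + k * m)).choose k - n.choose k : ℝ)) := by
    calc _ ≤ ∑ j : Fin m, ‖∑ t ∈ T, y (L ∘ t) - ∑ t ∈ T', y (L ∘ φ j t)‖ := norm_sum_le _ _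
      _ ≤ ∑ j : Fin m, _ := Finset.sum_le_sum fun j _ => hφ j
      _ = _ := by simp
  have h3 : (m : ℝ) • ∑ t ∈ T, y (L ∘ t) =
      ∑ j : Fin m, (∑ t ∈ T, y (L ∘ t) - ∑ t ∈ T', y (L ∘ φ j t)) +
      ∑ j : Fin m, ∑ t ∈ T', y (L ∘ φ j t) := by
    rw [← Finset.sum_add_distrib]
    simp [← Nat.cast_smul_eq_nsmul ℝ]
  have h4 : (m : ℝ) * ‖∑ t ∈ T, y (L ∘ t)‖ ≤
      m * (C * ((n + (l + k * m)).choose k - n.choose k : ℝ) + η * n.choose k) := by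
    have := (norm_add_le _ _).trans (add_le_add h2 h1)
    rw [← h3, norm_smul, Real.norm_natCast] at this
    linarith
  exact le_of_mul_le_mul_left h4 (by exact_mod_cast hm)

theorem cesaro_zero {k : ℕ} (y : (Fin (k+1) → ℕ) → X) (C : ℝ) (hC : ∀ s, ‖y s‖ ≤ C)
    (L : ℕ → ℕ) (hL : StrictMono L)
    (h : ∀ η > 0, ∃ l m : ℕ, 0 < m ∧ ∀ t : Fin (k+1) → ℕ, StrictMono t →
      ‖∑ j : Fin m, y (fun i => L (t i + l + i * m + j))‖ ≤ η * m) :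
    KCesaroSummableTo L y 0 := by
  have hC0 : 0 ≤ C := (norm_nonneg _).trans (hC 0)
  unfold KCesaroSummableTo
  rw [Metric.tendsto_atTop]
  intro ε hε
  obtain ⟨l, m, hm, hη⟩ := h (ε / 2) (by positivity)
  set q := l + (k+1) * m with hq
  obtain ⟨N0, hN0⟩ := exists_nat_gt (C * q * (k + 1) / (ε / 2))
  refine ⟨N0 + q + k + 1, fun N hN => ?_⟩
  obtain ⟨n, rfl⟩ : ∃ n, N = n + q := ⟨N - q, by omega⟩
  have hb := cesaro_bound y C hC L l m hm (ε / 2) hη n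
  rw [dist_zero_right, kSub_sum hL, norm_smul, norm_inv, Real.norm_natCast]
  rw [← hq] at hb
  have hpos : (0 : ℝ) < (n + q).choose (k+1) := by
    exact_mod_cast Nat.choose_pos (by omega)
  rw [inv_mul_lt_iff₀ hpos]
  refine lt_of_le_of_lt hb ?_
  have c1 : ((n + q).choose (k+1) : ℝ) - n.choose (k+1) ≤ q * (n + q).choose k := by
    have := choose_add_le k n q
    have : ((n + q).choose (k+1) : ℝ) ≤ n.choose (k+1) + q * (n + q).choose k := by
      exact_mod_cast this
    linarith
  have c2 : ((n + q).choose (k+1) : ℝ) * (k + 1) = (n + q).choose k * ((n + q - k : ℕ) : ℝ) := by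
    exact_mod_cast Nat.choose_succ_right_eq (n + q) k
  have c3 : (n.choose (k+1) : ℝ) ≤ (n + q).choose (k+1) := by
    exact_mod_cast Nat.choose_le_choose _ (Nat.le_add_right _ _)
  have hD : (N0 : ℝ) ≤ ((n + q - k : ℕ) : ℝ) := by
    exact_mod_cast (by omega : N0 ≤ n + q - k)
  have hDpos : (0 : ℝ) < ((n + q - k : ℕ) : ℝ) := by
    exact_mod_cast (by omega : 0 < n + q - k)
  set D := ((n + q - k : ℕ) : ℝ)
  rw [div_lt_iff₀ (by positivity)] at hN0
  have c4 : C * (q * ((n + q).choose k : ℝ)) < ε / 2 * (n + q).choose (k+1) := by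
    have e : ((n + q).choose k : ℝ) = (n + q).choose (k+1) * (k + 1) / D := by
      rw [c2]; field_simp
    rw [e]
    have : C * (q * (((n + q).choose (k+1) : ℝ) * (k + 1) / D)) =
        (C * q * (k + 1) / D) * (n + q).choose (k+1) := by ring
    rw [this]
    refine mul_lt_mul_of_pos_right ?_ hpos
    rw [div_lt_iff₀ hDpos]
    nlinarith
  have c5 : C * (((n + q).choose (k+1) : ℝ) - n.choose (k+1)) ≤
    C * (q * (n + q).choose k) := mul_le_mul_of_nonneg_left c1 hC0
  have c6 : ε / 2 * (n.choose (k+1) : ℝ) ≤ ε / 2 * (n + q).choose (k+1) :=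
    mul_le_mul_of_nonneg_left c3 (by positivity)
  linarith

theorem cesaro_case {k : ℕ} (y : (Fin (k+1) → ℕ) → X) (C : ℝ) (hC : ∀ s, ‖y s‖ ≤ C)
    (ρ : Seminorm ℝ (ℕ →₀ ℝ)) (M : ℕ → ℕ) (hM : StrictMono M) (δ : ℕ → ℝ) (hδ : IsNullPos δ)
    (hgen : Generates ρ y M (fun n => Finsupp.single n (1 : ℝ)) δ)
    (hρ : ∀ c > 0, ∃ m : ℕ, ρ (∑ j ∈ Finset.range m, Finsupp.single j 1) < c * m)
    (L : ℕ → ℕ) (hL : StrictMono L) (hLM : Set.range L ⊆ Set.range M) :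
    KCesaroSummableTo L y 0 := by
  apply cesaro_zero y C hC L hL
  intro η hη
  obtain ⟨m, hm⟩ := hρ (η / 2) (by positivity)
  have hm0 : m ≠ 0 := by
    rintro rfl
    simp at hm
  obtain ⟨m', rfl⟩ := Nat.exists_eq_succ_of_ne_zero hm0
  obtain ⟨l, hl, hml⟩ := ((hδ.2.eventually (gt_mem_nhds (show (0:ℝ) < η / 2 by positivity))).and
    (eventually_ge_atTop m')).exists
  refine ⟨l, m' + 1, Nat.succ_pos _, fun t ht => ?_⟩
  have hlt : ∀ (i i' : Fin (k+1)) (j j' : Fin (m'+1)), i < i' →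
      t i + l + i * (m'+1) + j < t i' + l + i' * (m'+1) + j' := by
    intro i i' j j' h
    have h1 := ht h
    have h2 : ((i : ℕ) + 1) * (m'+1) ≤ i' * (m'+1) := Nat.mul_le_mul_right _ h
    have h3 := j.2
    rw [add_mul, one_mul] at h2
    omega
  have hML : M l ≤ L l := by
    choose f hf using fun n => hLM ⟨n, rfl⟩
    have hfm : StrictMono f := by
      intro a b hab
      have := hL hab
      rw [← hf, ← hf] at this
      exact hM.lt_iff_lt.1 this
    rw [← hf]
    exact hM.monotone (hfm.id_le l)
  have := hgen m' l hml (fun j i => L (t i + l + i * (m'+1) + j)) (by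
    refine ⟨fun j => ⟨fun i i' h => hL (hlt i i' j j h), fun i => hLM ⟨_, rfl⟩⟩,
      fun i j j' h => hL ?_, fun i hi j j' => hL ?_⟩
    · have : (j : ℕ) < j' := h
      omega
    · exact hlt i ⟨(i : ℕ) + 1, hi⟩ j j' (Fin.lt_def.2 (Nat.lt_succ_self _)))
    (fun j i => hML.trans (hL.monotone (by omega))) (fun _ => 1) (fun _ => by simp)
  simp only [one_smul] at this
  rw [Finset.sum_range] at hm
  have h2 := (abs_le.1 this).2
  push_cast at hm ⊢
  have hm1 : (0 : ℝ) ≤ m' := Nat.cast_nonneg _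
  nlinarith

end Normed

theorem wc_of_compact {X : Type*} [NormedAddCommGroup X] [NormedSpace ℝ X] (K : Set X)
    (h : IsCompact (closure ((fun v => toWeakSpace ℝ X v) '' K))) : WC K := by
  intro α V y hy
  obtain ⟨z, _, hz⟩ := h.ultrafilter_le_nhds (V.map (fun a => toWeakSpace ℝ X (y a))) (by
    rw [le_principal_iff]
    change ∀ᶠ a in (V : Filter α), toWeakSpace ℝ X (y a) ∈ _
    exact Eventually.of_forall fun a => subset_closure ⟨_, hy a, rfl⟩)
  refine ⟨(toWeakSpace ℝ X).symm z, fun f => ?_⟩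
  have hc : Continuous (fun v : WeakSpace ℝ X => f ((toWeakSpace ℝ X).symm v)) :=
    WeakBilin.eval_continuous (topDualPairing ℝ X).flip f
  have hz' : Tendsto (fun a => toWeakSpace ℝ X (y a)) V (𝓝 z) := hz
  have := (hc.tendsto z).comp hz'
  simpa [Function.comp_def] using this

theorem bdd_of_compact {X : Type*} [NormedAddCommGroup X] [NormedSpace ℝ X] (K : Set X)
    (h : IsCompact (closure ((fun v => toWeakSpace ℝ X v) '' K))) :
    ∃ C, ∀ v ∈ K, ‖v‖ ≤ C := by
  obtain ⟨C, hC⟩ := banach_steinhaus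
    (g := fun v : K => NormedSpace.inclusionInDoubleDual ℝ X (v : X)) (by
      intro f
      have hc : Continuous (fun v : WeakSpace ℝ X => f ((toWeakSpace ℝ X).symm v)) :=
        WeakBilin.eval_continuous (topDualPairing ℝ X).flip f
      obtain ⟨C, hC⟩ := (h.image hc).isBounded.exists_norm_le
      refine ⟨C, fun v => ?_⟩
      have := hC (f v) ⟨toWeakSpace ℝ X v, subset_closure ⟨_, v.2, rfl⟩, by simp⟩
      simpa using this)
  refine ⟨C, fun v hv => ?_⟩
  have h1 := hC ⟨v, hv⟩
  have h2 : ‖NormedSpace.inclusionInDoubleDual ℝ X v‖ = ‖v‖ :=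
    (NormedSpace.inclusionInDoubleDualLi (𝕜 := ℝ) (E := X)).norm_map v
  rwa [h2] at h1

theorem Generates.congr {X : Type*} [NormedAddCommGroup X] [NormedSpace ℝ X]
    {ρ : Seminorm ℝ (ℕ →₀ ℝ)} {k : ℕ} {x y : (Fin k → ℕ) → X} {M : ℕ → ℕ} {e δ}
    (h : Generates ρ x M e δ) (hxy : ∀ s, StrictMono s → x s = y s) : Generates ρ y M e δ := by
  intro m l hml p hp hpl a ha
  have := h m l hml p hp hpl a ha
  simpa only [hxy _ ((hp.1 _).1)] using this

theorem cesaro_congr {X : Type*} [NormedAddCommGroup X] [NormedSpace ℝ X]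
    {k : ℕ} {x y : (Fin k → ℕ) → X} {L : ℕ → ℕ} {x₀ : X}
    (hL : StrictMono L) (h : KCesaroSummableTo L y 0) (hxy : ∀ s, StrictMono s → y s = x s - x₀) :
    KCesaroSummableTo L x x₀ := by
  unfold KCesaroSummableTo at *
  have h1 := h.add_const x₀
  rw [zero_add] at h1
  refine h1.congr' ?_
  filter_upwards [Filter.eventually_ge_atTop k] with n hn
  rw [kSub_sum hL, kSub_sum hL]
  have e : ∑ t ∈ kSubsetEnums k (Finset.range n), y (L ∘ t) =
      ∑ t ∈ kSubsetEnums k (Finset.range n), (x (L ∘ t) - x₀) :=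
    Finset.sum_congr rfl fun t ht => hxy _ (hL.comp (mem_kSub.1 ht).2)
  have hc : ((n.choose k : ℕ) : ℝ) ≠ 0 := by
    exact_mod_cast (Nat.choose_pos hn).ne'
  rw [e, Finset.sum_sub_distrib, Finset.sum_const, card_kSub, smul_sub,
    ← Nat.cast_smul_eq_nsmul ℝ, inv_smul_smul₀ hc, sub_add_cancel]
/-- Rosenthal-type dichotomy. Let `(x s)` be a weakly relatively
compact `k`-sequence in a Banach space `X` (the closure of its range in the weak
topology is weakly compact). Then there is an infinite `M ⊆ ℕ` such that either
`(x s)_{s ∈ [M]^k}` generates a `k`-spreading model equivalent to the usual basis of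
`ℓ¹`, or there is `x₀ ∈ X` such that `(x s)_{s ∈ [L]^k}` is `k`-Cesàro summable to `x₀`
for every infinite `L ⊆ M`. -/
theorem statement18 {X : Type*} [NormedAddCommGroup X] [NormedSpace ℝ X] [CompleteSpace X]
    (k : ℕ) (hk : 0 < k) (x : (Fin k → ℕ) → X)
    (hwrc : IsCompact (closure
      ((fun v => toWeakSpace ℝ X v) '' (x '' {s | IsEnum Set.univ s})))) :
    ∃ M : ℕ → ℕ, StrictMono M ∧
      ((∃ (ρ : Seminorm ℝ (ℕ →₀ ℝ)) (δ : ℕ → ℝ), IsNullPos δ ∧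
          IsSpreadingWith ρ (fun n => Finsupp.single n (1 : ℝ)) ∧
          Generates ρ x M (fun n => Finsupp.single n (1 : ℝ)) δ ∧
          EquivL1Basis ρ (fun n => Finsupp.single n (1 : ℝ))) ∨
        (∃ x₀ : X, ∀ L : ℕ → ℕ, StrictMono L → Set.range L ⊆ Set.range M →
          KCesaroSummableTo L x x₀)) := by
  classical
  obtain ⟨k, rfl⟩ := Nat.exists_eq_succ_of_ne_zero hk.ne'
  set K := x '' {s | IsEnum Set.univ s} with hKdef
  have hK : WC K := wc_of_compact K hwrc
  obtain ⟨C, hC⟩ := bdd_of_compact K hwrc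
  let x' : (Fin (k+1) → ℕ) → X := fun s => if StrictMono s then x s else x (fun i => (i : ℕ))
  have hx' : ∀ s, StrictMono s → x' s = x s := fun s hs => by simp [x', hs]
  have hx'K : ∀ s, x' s ∈ K := by
    intro s
    by_cases hs : StrictMono s
    · rw [hx' s hs]
      exact ⟨s, ⟨hs, fun _ => trivial⟩, rfl⟩
    · simp only [x', if_neg hs]
      exact ⟨_, ⟨fun i j h => h, fun _ => trivial⟩, rfl⟩
  have hxC : ∀ s, ‖x' s‖ ≤ C := fun s => hC _ (hx'K s)
  obtain ⟨x₀, hx₀⟩ := hK _ (VV (k+1)) x' hx'K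
  have hyC : ∀ s, ‖x' s - x₀‖ ≤ C + ‖x₀‖ := fun s =>
    (norm_sub_le _ _).trans (by linarith [hxC s])
  obtain ⟨ρx, hρx⟩ := exists_SM x' C hxC
  obtain ⟨ρy, hρy⟩ := exists_SM (fun s => x' s - x₀) _ hyC
  by_cases hcase : ∃ c > 0, ∀ m : ℕ, c * m ≤ ρy (∑ j ∈ Finset.range m, Finsupp.single j 1)
  · obtain ⟨c, hc, hcm⟩ := hcase
    obtain ⟨M, hM, hgen⟩ := hρx.generates hxC
    refine ⟨M, hM, Or.inl ⟨ρx, _, nullpos, hρx.spreading, hgen.congr hx', c / 4,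
      max C (c / 4), by positivity, le_max_right _ _,
      hρx.lowerL1 hx₀ hρy hK hx'K _ hyC c hcm, fun n a => ?_⟩⟩
    refine (hρx.upper hxC n a).trans ?_
    have : 0 ≤ ∑ i, |a i| := Finset.sum_nonneg fun i _ => abs_nonneg _
    exact mul_le_mul_of_nonneg_right (le_max_left _ _) this
  · push Not at hcase
    obtain ⟨M, hM, hgen⟩ := hρy.generates hyC
    refine ⟨M, hM, Or.inr ⟨x₀, fun L hL hLM => ?_⟩⟩
    refine cesaro_congr hL (cesaro_case _ _ hyC ρy M hM _ nullpos hgen hcase L hL hLM) ?_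
    intro s hs
    rw [hx' s hs]
end

section
/- For every Schauder basic spreading sequence (e_n)_n in a Banach space Y, there exists a 2-sequence (x_s)_{s∈[ℕ]^2} in c_0 (the Banach space of real sequences converging to 0, with the supremum norm) which admits a 2-spreading model (ẽ_n)_n equivalent to (e_n)_n. Moreover, if (e_n)_n is bimonotone, then (ẽ_n)_n can be chosen so that ‖Σ_{i=1}^n a_i ẽ_i‖_* = ‖Σ_{i=1}^n a_i e_i‖ for every n ∈ ℕ and a_1, …, a_n ∈ ℝ. -/
open scoped ZeroAtInfty

/-- `(e n)` is a spreading sequence in the (semi)normed space `Y`. -/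
def IsSpreadingSeq {Y : Type*} [SeminormedAddCommGroup Y] [NormedSpace ℝ Y]
    (e : ℕ → Y) : Prop :=
  ∀ (n : ℕ) (a : Fin n → ℝ) (f : Fin n → ℕ), StrictMono f →
    ‖∑ i, a i • e (i : ℕ)‖ = ‖∑ i, a i • e (f i)‖


theorem aux_support (ρ : Seminorm ℝ (ℕ →₀ ℝ)) (v : ℕ →₀ ℝ) :
    ∃ g : (ℕ →₀ ℝ) →ₗ[ℝ] ℝ, (∀ w, |g w| ≤ ρ w) ∧ g v = ρ v := by
  by_cases hv : v = 0
  · exact ⟨0, by simp, by simp [hv]⟩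
  obtain ⟨g, hg1, hg2⟩ := exists_extension_of_le_sublinear
    (LinearPMap.mkSpanSingleton (K := ℝ) v (ρ v) hv) ρ
    (fun c hc x => by rw [map_smul_eq_mul, Real.norm_of_nonneg hc.le])
    (fun x y => map_add_le_add ρ x y)
    (by
      rintro ⟨x, hx⟩
      obtain ⟨c, rfl⟩ := Submodule.mem_span_singleton.1 hx
      have h1 : (LinearPMap.mkSpanSingleton (K := ℝ) v (ρ v) hv) ⟨c • v, hx⟩ = c • ρ v :=
        LinearPMap.mkSpanSingleton'_apply v (ρ v) _ c hx
      rw [h1, map_smul_eq_mul, smul_eq_mul]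
      exact mul_le_mul_of_nonneg_right (le_abs_self c) (apply_nonneg ρ v))
  refine ⟨g, fun w => abs_le.2 ⟨?_, hg2 w⟩, ?_⟩
  · have := hg2 (-w)
    rw [map_neg, map_neg_eq_map] at this
    linarith
  · have := hg1 ⟨v, Submodule.mem_span_singleton_self v⟩
    rw [this]
    exact LinearPMap.mkSpanSingleton'_apply_self v (ρ v) _ _

/-- finitely many functionals almost norming the cube. -/
theorem aux_net (ρ : Seminorm ℝ (ℕ →₀ ℝ)) (t : ℕ) :
    ∃ (n : ℕ) (g : ℕ → (ℕ →₀ ℝ) →ₗ[ℝ] ℝ), (∀ k w, |g k w| ≤ ρ w) ∧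
      ∀ v : ℕ →₀ ℝ, (∀ i, |v i| ≤ 1) → (∀ i, t ≤ i → v i = 0) →
        ∃ k < n, ρ v - 1 / ((t : ℝ) + 1) ≤ g k v := by
  classical
  have hε : (0 : ℝ) < 1 / ((t : ℝ) + 1) := by positivity
  set ε := 1 / ((t : ℝ) + 1) with hεd
  let J : (Fin t → ℝ) →ₗ[ℝ] (ℕ →₀ ℝ) :=
    (Finsupp.lmapDomain ℝ ℝ (fun i : Fin t => (i : ℕ))) ∘ₗ
      (Finsupp.linearEquivFunOnFinite ℝ ℝ (Fin t)).symm.toLinearMap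
  have hJ1 : ∀ (b : Fin t → ℝ) (i : Fin t), J b i = b i := by
    intro b i
    simp only [J, LinearMap.comp_apply, Finsupp.lmapDomain_apply]
    exact Finsupp.mapDomain_apply Fin.val_injective _ i
  have hJ2 : ∀ (b : Fin t → ℝ) (i : ℕ), t ≤ i → J b i = 0 := by
    intro b i hi
    simp only [J, LinearMap.comp_apply, Finsupp.lmapDomain_apply]
    refine Finsupp.mapDomain_of_notMem_range _ _ ?_
    rintro ⟨j, rfl⟩
    exact absurd j.2 (not_lt.2 hi)
  choose φ hφ1 hφ2 using aux_support ρ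
  have hρc : Continuous (fun b => ρ (J b)) :=
    ((ρ.comp J).convexOn.locallyLipschitz).continuous
  have hU : ∀ b : Fin t → ℝ, {a | ρ (J a) - ε < φ (J b) (J a)} ∈ nhds b := by
    intro b
    refine IsOpen.mem_nhds (isOpen_lt (hρc.sub continuous_const) ?_) ?_
    · exact ((φ (J b)).comp J).continuous_of_finiteDimensional
    · simp only [Set.mem_ofPred_eq, hφ2]; linarith
  obtain ⟨s, -, hs⟩ := (isCompact_univ_pi (fun _ : Fin t => isCompact_Icc (a := (-1 : ℝ)) (b := 1))).elim_nhds_subcover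
    _ (fun b _ => hU b)
  refine ⟨s.toList.length, fun k => φ (J (s.toList.getD k 0)), fun k w => hφ1 _ w, ?_⟩
  intro v hv1 hv2
  have hvJ : J (fun i => v i) = v := by
    ext i
    by_cases hi : i < t
    · exact hJ1 _ ⟨i, hi⟩
    · rw [hJ2 _ _ (not_lt.1 hi), hv2 _ (not_lt.1 hi)]
  have hmem : (fun i : Fin t => v i) ∈ Set.univ.pi (fun _ : Fin t => Set.Icc (-1 : ℝ) 1) :=
    fun i _ => abs_le.1 (hv1 i)
  have := hs hmem
  simp only [Set.mem_iUnion] at this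
  obtain ⟨b, hb, hb2⟩ := this
  obtain ⟨k, hk, hkb⟩ := List.getElem_of_mem (Finset.mem_toList.2 hb)
  refine ⟨k, hk, ?_⟩
  beta_reduce
  rw [List.getD_eq_getElem _ _ hk, hkb]
  simp only [Set.mem_ofPred_eq, hvJ] at hb2
  exact hb2.le

theorem aux_main (ρ : Seminorm ℝ (ℕ →₀ ℝ))
    (hspr : IsSpreadingWith ρ (fun n => Finsupp.single n (1 : ℝ)))
    (htail : ∀ (v : ℕ →₀ ℝ) (c : ℕ), ρ (v.filter (c ≤ ·)) ≤ ρ v) :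
    ∃ (x : (Fin 2 → ℕ) → C₀(ℕ, ℝ)) (M : ℕ → ℕ) (δ : ℕ → ℝ),
      StrictMono M ∧ IsNullPos δ ∧
      Generates ρ x M (fun n => Finsupp.single n (1 : ℝ)) δ := by
  classical
  choose n g hg1 hg2 using aux_net ρ
  let P : ℕ → ℕ → Prop := fun q i => (Nat.unpair i).1 ≤ q ∧ (Nat.unpair i).2 < n (Nat.unpair i).1
  let X : (Fin 2 → ℕ) → ℕ → ℝ := fun s i =>
    if P (s 1) i then g (Nat.unpair i).1 (Nat.unpair i).2 (Finsupp.single (s 0) 1) else 0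
  have hfin : ∀ q, {i | P q i}.Finite := by
    intro q
    have h1 : (⋃ t ∈ Set.Iic q, (Nat.pair t) '' Set.Iio (n t)).Finite :=
      (Set.finite_Iic q).biUnion (fun t _ => (Set.finite_Iio _).image _)
    refine h1.subset ?_
    intro i hi
    simp only [Set.mem_iUnion]
    exact ⟨_, hi.1, _, hi.2, Nat.pair_unpair i⟩
  let x : (Fin 2 → ℕ) → C₀(ℕ, ℝ) := fun s =>
    { toFun := X s
      continuous_toFun := continuous_of_discreteTopology
      zero_at_infty' := by
        rw [Filter.cocompact_eq_cofinite]
        refine tendsto_const_nhds.congr' ?_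
        have : ∀ᶠ i in Filter.cofinite, ¬ P (s 1) i := by
          simpa [Filter.eventually_cofinite] using hfin (s 1)
        filter_upwards [this] with i hi
        simp [X, hi] }
  have hx : ∀ s i, x s i = X s i := fun s i => rfl
  refine ⟨x, id, fun l => 1 / ((l : ℝ) + 1), strictMono_id,
    ⟨fun l => by positivity, tendsto_one_div_add_atTop_nhds_zero_nat⟩, ?_⟩
  intro m l hml p hp hpl a ha
  obtain ⟨-, hmono, hcross⟩ := hp
  have hc : ∀ j j', p j 0 < p j' 1 := fun j j' => hcross 0 (by simp) j j'
  set v : ℕ →₀ ℝ := ∑ j, a j • Finsupp.single (p j 0) (1 : ℝ) with hv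
  have hρv : ρ (∑ j, a j • Finsupp.single (j : ℕ) (1 : ℝ)) = ρ v :=
    hspr (m + 1) a (fun j => p j 0) (hmono 0)
  have hS : ∀ i, (∑ j, a j • x (p j)) i = ∑ j, a j * X (p j) i := by
    intro i
    have : ∀ s : Finset (Fin (m+1)), (∑ j ∈ s, a j • x (p j)) i = ∑ j ∈ s, a j * X (p j) i := by
      intro s
      induction s using Finset.induction_on with
      | empty => simp
      | insert b s hb ih => 
        rw [Finset.sum_insert hb, Finset.sum_insert hb, ZeroAtInftyContinuousMap.add_apply, ih]
        rfl
    exact this _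
  have hinj : Function.Injective (fun j => p j 0) := (hmono 0).injective
  have hvp : ∀ j, v (p j 0) = a j := by
    intro j
    simp only [hv, Finsupp.finset_sum_apply, Finsupp.smul_apply, smul_eq_mul]
    rw [Finset.sum_eq_single j]
    · simp
    · intro b _ hb
      rw [Finsupp.single_eq_of_ne (fun h => hb (hinj h.symm))]; simp
    · simp
  have hv0 : ∀ i, (∀ j, p j 0 ≠ i) → v i = 0 := by
    intro i hi
    simp only [hv, Finsupp.finset_sum_apply, Finsupp.smul_apply, smul_eq_mul]
    refine Finset.sum_eq_zero fun j _ => ?_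
    rw [Finsupp.single_eq_of_ne (hi j).symm]; simp
  rw [hρv, abs_le]
  constructor
  · obtain ⟨k, hk, hkv⟩ := hg2 (p 0 1) v
      (by
        intro i
        by_cases h : ∃ j, p j 0 = i
        · obtain ⟨j, rfl⟩ := h
          rw [hvp]; exact abs_le.2 (ha j)
        · push Not at h
          rw [hv0 i h]; simp)
      (by
        intro i hi
        refine hv0 i fun j hj => ?_
        have := hc j 0
        omega)
    have h1 : (∑ j, a j • x (p j)) (Nat.pair (p 0 1) k) = g (p 0 1) k v := by
      rw [hS, hv, map_sum]
      refine Finset.sum_congr rfl fun j _ => ?_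
      have : P (p j 1) (Nat.pair (p 0 1) k) := by
        simp only [P, Nat.unpair_pair]
        exact ⟨(hmono 1).monotone (Fin.zero_le j), hk⟩
      simp only [X, if_pos this, Nat.unpair_pair, map_smul, smul_eq_mul]
    have h2 : g (p 0 1) k v ≤ ‖∑ j, a j • x (p j)‖ := by
      rw [← h1, ← ZeroAtInftyContinuousMap.norm_toBCF_eq_norm]
      exact (le_abs_self _).trans
        ((∑ j, a j • x (p j)).toBCF.norm_coe_le_norm (Nat.pair (p 0 1) k))
    have h3 : 1 / (((p 0 1 : ℕ) : ℝ) + 1) ≤ 1 / ((l : ℝ) + 1) := by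
      have : (l : ℝ) ≤ (p 0 1 : ℕ) := by exact_mod_cast hpl 0 1
      gcongr
    linarith
  · have hle : ‖∑ j, a j • x (p j)‖ ≤ ρ v := by
      rw [← ZeroAtInftyContinuousMap.norm_toBCF_eq_norm]
      refine (BoundedContinuousFunction.norm_le (apply_nonneg ρ v)).2 fun i => ?_
      change |(∑ j, a j • x (p j)) i| ≤ ρ v
      rw [hS]
      by_cases hi : ∃ j, P (p j 1) i
      · have hex : ∃ c, ∀ j, c ≤ p j 0 ↔ P (p j 1) i := by
          have hne : (Finset.univ.filter fun j => P (p j 1) i).Nonempty := by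
            obtain ⟨j, hj⟩ := hi
            exact ⟨j, by simpa using hj⟩
          refine ⟨p (Finset.min' _ hne) 0, fun j => ?_⟩
          rw [(hmono 0).le_iff_le]
          constructor
          · intro h
            have h4 := Finset.min'_mem _ hne
            simp only [Finset.mem_filter, Finset.mem_univ, true_and] at h4
            exact ⟨h4.1.trans ((hmono 1).monotone h), h4.2⟩
          · intro h
            exact Finset.min'_le _ _ (by simpa using h)
        obtain ⟨c, hcc⟩ := hex
        have h5 : v.filter (c ≤ ·) = ∑ j, a j • (if P (p j 1) i then Finsupp.single (p j 0) (1 : ℝ) else 0) := by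
          rw [hv]
          have := map_sum (Finsupp.filterAddHom (M := ℝ) (c ≤ ·)) (fun j => a j • Finsupp.single (p j 0) (1 : ℝ)) Finset.univ
          refine this.trans (Finset.sum_congr rfl fun j _ => ?_)
          change Finsupp.filter _ _ = _
          rw [Finsupp.filter_smul]
          congr 1
          split_ifs with h
          · exact Finsupp.filter_single_of_pos _ ((hcc j).2 h)
          · exact Finsupp.filter_single_of_neg _ (fun h' => h ((hcc j).1 h'))
        have h6 : ∑ j, a j * X (p j) i = g (Nat.unpair i).1 (Nat.unpair i).2 (v.filter (c ≤ ·)) := by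
          rw [h5, map_sum]
          refine Finset.sum_congr rfl fun j _ => ?_
          simp only [X, map_smul, smul_eq_mul]
          split_ifs <;> simp
        rw [h6]
        exact (hg1 _ _ _).trans (htail v c)
      · push Not at hi
        rw [Finset.sum_eq_zero]
        · simp
        · intro j _
          simp [X, hi j]
    have : (0 : ℝ) ≤ 1 / ((l : ℝ) + 1) := by positivity
    linarith

/-- Tail projection. -/
noncomputable def auxTail (c : ℕ) : (ℕ →₀ ℝ) →ₗ[ℝ] (ℕ →₀ ℝ) where
  toFun v := v.filter (c ≤ ·)
  map_add' _ _ := Finsupp.filter_add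
  map_smul' _ _ := Finsupp.filter_smul

/-- Every Schauder basic spreading sequence `(e n)` in a Banach space
`Y` is equivalent to a `2`-spreading model `(ẽ n)` admitted by some `2`-sequence in
`c₀` (realized on `ℕ →₀ ℝ` with unit vectors `Finsupp.single · 1` and a seminorm `ρ`);
moreover, if `(e n)` is bimonotone then `(ẽ n)` can be chosen isometric to `(e n)`. -/
theorem statement19 {Y : Type*} [NormedAddCommGroup Y] [NormedSpace ℝ Y] [CompleteSpace Y]
    (e : ℕ → Y) (hspr : IsSpreadingSeq e) (hli : LinearIndependent ℝ e)
    (hbasic : ∃ C : ℝ, 1 ≤ C ∧ ∀ (a : ℕ → ℝ) (m n : ℕ), m ≤ n →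
      ‖∑ i ∈ Finset.range m, a i • e i‖ ≤ C * ‖∑ i ∈ Finset.range n, a i • e i‖) :
    (∃ (x : (Fin 2 → ℕ) → C₀(ℕ, ℝ)) (ρ : Seminorm ℝ (ℕ →₀ ℝ)) (M : ℕ → ℕ) (δ : ℕ → ℝ),
      StrictMono M ∧ IsNullPos δ ∧
      IsSpreadingWith ρ (fun n => Finsupp.single n (1 : ℝ)) ∧
      Generates ρ x M (fun n => Finsupp.single n (1 : ℝ)) δ ∧
      ∃ c C : ℝ, 0 < c ∧ c ≤ C ∧ ∀ (n : ℕ) (a : Fin n → ℝ),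
        c * ‖∑ i, a i • e (i : ℕ)‖ ≤ ρ (∑ i, a i • Finsupp.single (i : ℕ) (1 : ℝ)) ∧
        ρ (∑ i, a i • Finsupp.single (i : ℕ) (1 : ℝ)) ≤ C * ‖∑ i, a i • e (i : ℕ)‖) ∧
    ((∀ (a : ℕ → ℝ) (j m n : ℕ), j ≤ m → m ≤ n →
        ‖∑ i ∈ Finset.Ico j m, a i • e i‖ ≤ ‖∑ i ∈ Finset.range n, a i • e i‖) →
      ∃ (x : (Fin 2 → ℕ) → C₀(ℕ, ℝ)) (ρ : Seminorm ℝ (ℕ →₀ ℝ)) (M : ℕ → ℕ) (δ : ℕ → ℝ),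
        StrictMono M ∧ IsNullPos δ ∧
        IsSpreadingWith ρ (fun n => Finsupp.single n (1 : ℝ)) ∧
        Generates ρ x M (fun n => Finsupp.single n (1 : ℝ)) δ ∧
        ∀ (n : ℕ) (a : Fin n → ℝ),
          ρ (∑ i, a i • Finsupp.single (i : ℕ) (1 : ℝ)) = ‖∑ i, a i • e (i : ℕ)‖) := by
  classical
  let T : (ℕ →₀ ℝ) →ₗ[ℝ] Y := Finsupp.linearCombination ℝ e
  have hTs : ∀ (n : ℕ) (a : Fin n → ℝ) (f : Fin n → ℕ),
      T (∑ i, a i • Finsupp.single (f i) (1 : ℝ)) = ∑ i, a i • e (f i) := by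
    intro n a f
    simp [T, map_sum]
  have hTr : ∀ (v : ℕ →₀ ℝ) (N : ℕ), (∀ i, N ≤ i → v i = 0) →
      T v = ∑ i ∈ Finset.range N, v i • e i := by
    intro v N h
    refine Finsupp.linearCombination_apply_of_mem_supported ℝ ?_
    intro i hi
    by_contra hcon
    exact (Finsupp.mem_support_iff.1 hi) (h i (by simpa using hcon))
  have hTt : ∀ (v : ℕ →₀ ℝ) (N c : ℕ), c ≤ N → (∀ i, N ≤ i → v i = 0) →
      T (auxTail c v) = ∑ i ∈ Finset.Ico c N, v i • e i := by
    intro v N c hcN h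
    have happ : ∀ i, auxTail c v i = if c ≤ i then v i else 0 := fun i => rfl
    rw [hTr _ N (fun i hi => by rw [happ, h i hi]; simp)]
    simp only [happ, ite_smul, zero_smul]
    rw [← Finset.sum_filter]
    refine Finset.sum_congr ?_ fun _ _ => rfl
    ext i; simp; tauto
  have hbd : ∀ (v : ℕ →₀ ℝ) (c : ℕ), ∃ N, c ≤ N ∧ ∀ i, N ≤ i → v i = 0 := by
    intro v c
    refine ⟨max c (v.support.sup id + 1), le_max_left _ _, fun i hi => ?_⟩
    by_contra hcon
    have h1 : i ≤ v.support.sup id := Finset.le_sup (f := id) (Finsupp.mem_support_iff.2 hcon)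
    have h2 := (le_max_right _ _).trans hi
    omega
  constructor
  · obtain ⟨C, hC1, hC⟩ := hbasic
    let p : ℕ → Seminorm ℝ (ℕ →₀ ℝ) := fun c => (normSeminorm ℝ Y).comp (T ∘ₗ auxTail c)
    have hp : ∀ c v, p c v = ‖T (auxTail c v)‖ := fun c v => rfl
    have hpC : ∀ c v, p c v ≤ (1 + C) * ‖T v‖ := by
      intro c v
      obtain ⟨N, hcN, hN⟩ := hbd v c
      rw [hp, hTt v N c hcN hN, hTr v N hN, Finset.sum_Ico_eq_sub _ hcN]
      have := norm_sub_le (∑ i ∈ Finset.range N, v i • e i) (∑ i ∈ Finset.range c, v i • e i)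
      have := hC v c N hcN
      linarith
    have hbdd : ∀ v, BddAbove (Set.range fun c => p c v) :=
      fun v => ⟨_, by rintro _ ⟨c, rfl⟩; exact hpC c v⟩
    have hB : BddAbove (Set.range p) := Seminorm.bddAbove_range_iff.2 hbdd
    have hρ : ∀ v, (⨆ c, p c) v = ⨆ c, p c v := fun v => Seminorm.iSup_apply hB
    have h0 : ∀ v, auxTail 0 v = v := by
      intro v; ext i; change (if 0 ≤ i then v i else 0) = v i; simp
    have hpf : ∀ (n : ℕ) (a : Fin n → ℝ) (f : Fin n → ℕ) (c : ℕ), StrictMono f →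
        p c (∑ i, a i • Finsupp.single (f i) (1 : ℝ)) =
          ‖∑ i : Fin n, (if c ≤ f i then a i else 0) • e (i : ℕ)‖ := by
      intro n a f c hf
      rw [hspr n _ f hf, hp, map_sum, ← hTs]
      congr 2
      refine Finset.sum_congr rfl fun i _ => ?_
      rw [map_smul]
      change a i • Finsupp.filter _ _ = _
      split_ifs with h
      · rw [Finsupp.filter_single_of_pos _ h]
      · rw [Finsupp.filter_single_of_neg _ h]; simp
    have hsp : IsSpreadingWith (⨆ c, p c) (fun n => Finsupp.single n (1 : ℝ)) := by
      intro n a f hf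
      have hid : StrictMono (fun i : Fin n => (i : ℕ)) := fun _ _ h => h
      rw [hρ, hρ]
      apply le_antisymm
      · refine ciSup_le fun c => ?_
        obtain ⟨c', hc'⟩ : ∃ c', ∀ i : Fin n, c' ≤ f i ↔ c ≤ i := by
          by_cases h : c < n
          · exact ⟨f ⟨c, h⟩, fun i => by rw [hf.le_iff_le]; rfl⟩
          · refine ⟨(Finset.univ.sup f) + 1, fun i => ?_⟩
            have h1 : f i ≤ Finset.univ.sup f := Finset.le_sup (Finset.mem_univ i)
            have h2 := i.2
            omega
        refine le_trans (le_of_eq ?_) (le_ciSup (hbdd _) c')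
        rw [hpf n a (fun i => (i : ℕ)) c hid, hpf n a f c' hf]
        simp only [hc']
      · refine ciSup_le fun c => ?_
        obtain ⟨c', hc'⟩ : ∃ c', ∀ i : Fin n, c' ≤ (i : ℕ) ↔ c ≤ f i := by
          by_cases h : ∃ k, ∃ h : k < n, c ≤ f ⟨k, h⟩
          · refine ⟨Nat.find h, fun i => ⟨fun hi => ?_, fun hi => Nat.find_min' h ⟨i.2, hi⟩⟩⟩
            obtain ⟨h1, h2⟩ := Nat.find_spec h
            exact h2.trans (hf.monotone hi)
          · push Not at h
            refine ⟨n, fun i => ?_⟩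
            have h1 := h i i.2
            have h2 := i.2
            have h3 : f i < c := h1
            omega
        refine le_trans (le_of_eq ?_) (le_ciSup (hbdd _) c')
        rw [hpf n a (fun i => (i : ℕ)) c' hid, hpf n a f c hf]
        simp only [hc']
    have htl : ∀ (v : ℕ →₀ ℝ) (c : ℕ), (⨆ c, p c) (v.filter (c ≤ ·)) ≤ (⨆ c, p c) v := by
      intro v c
      rw [hρ, hρ]
      refine ciSup_le fun d => ?_
      refine le_trans (le_of_eq ?_) (le_ciSup (hbdd v) (max c d))
      change ‖T (auxTail d (auxTail c v))‖ = ‖T (auxTail (max c d) v)‖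
      congr 2
      ext i
      change (if d ≤ i then (if c ≤ i then v i else 0) else 0) = if max c d ≤ i then v i else 0
      split_ifs <;> first | rfl | omega
    obtain ⟨x, M, δ, h1, h2, h3⟩ := aux_main _ hsp htl
    refine ⟨x, _, M, δ, h1, h2, hsp, h3, 1, 1 + C, one_pos, by linarith, fun n a => ?_⟩
    rw [← hTs n a (fun i => (i : ℕ)), hρ, one_mul]
    refine ⟨?_, ciSup_le fun c => hpC c _⟩
    refine le_trans (le_of_eq ?_) (le_ciSup (hbdd _) 0)
    rw [hp, h0]
  · intro hbi
    have hsp : IsSpreadingWith ((normSeminorm ℝ Y).comp T) (fun n => Finsupp.single n (1 : ℝ)) := by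
      intro n a f hf
      change ‖T _‖ = ‖T _‖
      rw [hTs n a f, hTs n a (fun i => (i : ℕ))]
      exact hspr n a f hf
    obtain ⟨x, M, δ, h1, h2, h3⟩ := aux_main _ hsp (by
      intro v c
      change ‖T (auxTail c v)‖ ≤ ‖T v‖
      obtain ⟨N, hcN, hN⟩ := hbd v c
      rw [hTt v N c hcN hN, hTr v N hN]
      exact hbi v c N N hcN le_rfl)
    refine ⟨x, _, M, δ, h1, h2, hsp, h3, fun n a => ?_⟩
    change ‖T _‖ = _
    rw [hTs n a (fun i => (i : ℕ))]
end
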